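/- arXiv:2502.19277 — 5 statements merged into one kernel-verified Lean document; each statement's English description precedes it below -/
import Mathlib

section
/- Let x^m be a grid function with δ⁻x^m_j ≠ 0 for all j = 1,…,J, let Δt > 0, and let x^{m+1/2} be the unique solution of the predictor equations x^{m+1/2}_j − x^m_j − Δt α^m_j δ²x^{m+1/2}_j = 0 (j = 1,…,J), where q^m_j = |δ⁻x^m_j| and α^m_j = ½(h_j + h_{j+1})/(h_j(q^m_j)² + h_{j+1}(q^m_{j+1})²). Then there exists exactly one grid function x^{m+1} : {1,…,J} → ℝ^d satisfying the corrector equations ½(h_j|δ⁻x^{m+1/2}_j|² + h_{j+1}|δ⁻x^{m+1/2}_{j+1}|²)(x^{m+1}_j − x^m_j)/Δt − ½[(δ⁺x^{m+1}_j − δ⁻x^{m+1}_j) + (δ⁺x^m_j − δ⁻x^m_j)] = 0 for j = 1,…,J. -/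
open scoped BigOperators RealInnerProductSpace

noncomputable section

/-- Backward difference quotient of a grid function. -/
def deltaM {d : ℕ} (h : ℤ → ℝ) (v : ℤ → EuclideanSpace ℝ (Fin d)) (j : ℤ) :
    EuclideanSpace ℝ (Fin d) :=
  (h j)⁻¹ • (v j - v (j - 1))

/-- Forward difference quotient of a grid function. -/
def deltaP {d : ℕ} (h : ℤ → ℝ) (v : ℤ → EuclideanSpace ℝ (Fin d)) (j : ℤ) :
    EuclideanSpace ℝ (Fin d) :=
  (h (j + 1))⁻¹ • (v (j + 1) - v j)

/-- Discrete second difference of a grid function. -/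
def delta2 {d : ℕ} (h : ℤ → ℝ) (v : ℤ → EuclideanSpace ℝ (Fin d)) (j : ℤ) :
    EuclideanSpace ℝ (Fin d) :=
  ((h j + h (j + 1)) / 2)⁻¹ • (deltaP h v j - deltaM h v j)

section

variable {d : ℕ}

lemma deltaP_eq_deltaM_succ (h : ℤ → ℝ) (v : ℤ → EuclideanSpace ℝ (Fin d)) (j : ℤ) :
    deltaP h v j = deltaM h v (j + 1) := by
  simp [deltaP, deltaM]

lemma deltaM_add (h : ℤ → ℝ) (u v : ℤ → EuclideanSpace ℝ (Fin d)) (j : ℤ) :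
    deltaM h (u + v) j = deltaM h u j + deltaM h v j := by
  simp only [deltaM, Pi.add_apply]
  module

lemma deltaM_smul (h : ℤ → ℝ) (c : ℝ) (v : ℤ → EuclideanSpace ℝ (Fin d)) (j : ℤ) :
    deltaM h (c • v) j = c • deltaM h v j := by
  simp only [deltaM, Pi.smul_apply]
  module

lemma deltaM_periodic {J : ℤ} {h : ℤ → ℝ} {v : ℤ → EuclideanSpace ℝ (Fin d)}
    (hper : Function.Periodic h J) (hv : Function.Periodic v J) :
    Function.Periodic (deltaM h v) J := by
  intro j
  have e : j + J - 1 = j - 1 + J := by ring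
  simp only [deltaM, e, hper j, hv j, hv (j - 1)]

/-- A grid function whose backward differences all vanish is constant. -/
lemma eq_of_deltaM_eq_zero {h : ℤ → ℝ} (hpos : ∀ j, 0 < h j)
    {v : ℤ → EuclideanSpace ℝ (Fin d)} (hv : ∀ j, deltaM h v j = 0) (i j : ℤ) : v i = v j := by
  have step : ∀ j, v (j + 1) = v j := fun j => by
    have := hv (j + 1)
    simpa [deltaM, (hpos (j + 1)).ne', sub_eq_zero] using this
  have base : ∀ j, v j = v 0 := fun j => by
    induction j using Int.induction_on with
    | zero => rfl
    | succ n ih => rw [step, ih]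
    | pred n ih => rw [← ih, ← step (-(n : ℤ) - 1), sub_add_cancel]
  rw [base i, base j]

/-- Discrete product rule behind summation by parts. -/
lemma inner_deltaM_succ_sub {h : ℤ → ℝ} (hpos : ∀ j, 0 < h j)
    (v : ℤ → EuclideanSpace ℝ (Fin d)) (j : ℤ) :
    ⟪v j, deltaM h v (j + 1) - deltaM h v j⟫ =
      ⟪v (j + 1), deltaM h v (j + 1)⟫ - ⟪v j, deltaM h v j⟫
        - h (j + 1) * ‖deltaM h v (j + 1)‖ ^ 2 := by
  have e : v (j + 1) = v j + h (j + 1) • deltaM h v (j + 1) := by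
    simp [deltaM, smul_smul, (hpos (j + 1)).ne']
  have e' := congrArg (fun x => ⟪x, deltaM h v (j + 1)⟫) e
  simp only [inner_add_left, real_inner_smul_left, real_inner_self_eq_norm_sq] at e'
  rw [inner_sub_right]
  linarith

/-- The periodic grid functions with values in `ℝ^d`. -/
def periodicGrid (d : ℕ) (J : ℕ) : Submodule ℝ (ℤ → EuclideanSpace ℝ (Fin d)) where
  carrier := {v | Function.Periodic v (J : ℤ)}
  add_mem' hu hv := hu.add hv
  zero_mem' _ := rfl
  smul_mem' c _ hv := hv.smul c

lemma finiteDimensional_periodicGrid {J : ℕ} (hJ : 0 < J) :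
    FiniteDimensional ℝ (periodicGrid d J) := by
  let R : periodicGrid d J →ₗ[ℝ] (Fin J → EuclideanSpace ℝ (Fin d)) :=
    { toFun v i := v.1 (i : ℕ)
      map_add' _ _ := rfl
      map_smul' _ _ := rfl }
  refine FiniteDimensional.of_injective R fun u v huv => Subtype.ext (funext fun j => ?_)
  have hJ' : (0 : ℤ) < J := by exact_mod_cast hJ
  obtain ⟨n, hn⟩ := Int.eq_ofNat_of_zero_le (Int.emod_nonneg j hJ'.ne')
  have hnJ : n < J := by have := Int.emod_lt_of_pos j hJ'; omega
  have key : ∀ w : periodicGrid d J, w.1 j = w.1 n := fun w => by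
    have hw := Function.Periodic.int_mul w.2 (j / J) (j % J)
    rwa [mul_comm, Int.cast_id, Int.emod_add_mul_ediv, hn] at hw
  rw [key u, key v]
  exact congrFun huv ⟨n, hnJ⟩

/-- The energy identity forces homogeneous periodic solutions to vanish. -/
lemma eq_zero_of_homogeneous {J : ℕ} (hJ : 0 < J) {h w : ℤ → ℝ} (hpos : ∀ j, 0 < h j)
    (hper : Function.Periodic h (J : ℤ)) (hw : ∀ j, 0 ≤ w j) (hw' : ∃ j, 0 < w j)
    {v : ℤ → EuclideanSpace ℝ (Fin d)} (hv : Function.Periodic v (J : ℤ))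
    (heq : ∀ j, w j • v j - (2⁻¹ : ℝ) • (deltaM h v (j + 1) - deltaM h v j) = 0) : v = 0 := by
  have hD := deltaM_periodic hper hv
  let G : ℤ → ℝ := fun j => ⟪v j, deltaM h v j⟫
  let e : ℤ → ℝ := fun j => w j * ‖v j‖ ^ 2 + 2⁻¹ * (h (j + 1) * ‖deltaM h v (j + 1)‖ ^ 2)
  have he0 : ∀ j, 0 ≤ e j := fun j => by
    have := hw j
    have := hpos (j + 1)
    positivity
  have heG : ∀ j, e j = 2⁻¹ * (G (j + 1) - G j) := fun j => by
    have h1 := congrArg (fun x => ⟪v j, x⟫) (heq j)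
    simp only [inner_sub_right (v j) (w j • v j), real_inner_smul_right, inner_zero_right,
      real_inner_self_eq_norm_sq, inner_deltaM_succ_sub hpos] at h1
    simp only [e, G]
    linarith
  have he : ∀ k, e k = 0 := fun k => by
    have hsum : ∑ i ∈ Finset.range J, e (k + i) = 0 := by
      have ht := Finset.sum_range_sub (fun i : ℕ => G (k + i)) J
      have hGJ : G (k + J) = G k := by simp only [G, hv k, hD k]
      simp only [heG, ← Finset.mul_sum]
      push_cast at ht
      simp only [← add_assoc] at ht
      rw [ht]
      simp [hGJ]
    have := (Finset.sum_eq_zero_iff_of_nonneg fun (i : ℕ) _ => he0 (k + i)).1 hsum 0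
      (Finset.mem_range.2 hJ)
    simpa using this
  have hsplit : ∀ j, w j * ‖v j‖ ^ 2 = 0 ∧ h (j + 1) * ‖deltaM h v (j + 1)‖ ^ 2 = 0 := fun j => by
    have h1 : 0 ≤ w j * ‖v j‖ ^ 2 := mul_nonneg (hw j) (sq_nonneg _)
    have h2 : 0 ≤ h (j + 1) * ‖deltaM h v (j + 1)‖ ^ 2 :=
      mul_nonneg (hpos _).le (sq_nonneg _)
    have h3 := he j
    simp only [e] at h3
    constructor <;> linarith
  have hconst : ∀ j, deltaM h v j = 0 := fun j => by
    simpa [(hpos j).ne'] using (hsplit (j - 1)).2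
  obtain ⟨k, hk⟩ := hw'
  have hvk : v k = 0 := by simpa [hk.ne'] using (hsplit k).1
  exact funext fun j => (eq_of_deltaM_eq_zero hpos hconst j k).trans hvk

/-- Unique solvability of the periodic linear system `w v - ½ (δ⁺v - δ⁻v) = f` for nonnegative
weights `w` that do not vanish identically. -/
lemma existsUnique_periodic_solution {J : ℕ} (hJ : 0 < J) {h w : ℤ → ℝ} (hpos : ∀ j, 0 < h j)
    (hper : Function.Periodic h (J : ℤ)) (hw : ∀ j, 0 ≤ w j) (hw' : ∃ j, 0 < w j)
    (hwper : Function.Periodic w (J : ℤ))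
    {f : ℤ → EuclideanSpace ℝ (Fin d)} (hf : Function.Periodic f (J : ℤ)) :
    ∃! v : ℤ → EuclideanSpace ℝ (Fin d), Function.Periodic v (J : ℤ) ∧
      ∀ j, w j • v j - (2⁻¹ : ℝ) • (deltaM h v (j + 1) - deltaM h v j) = f j := by
  have := finiteDimensional_periodicGrid (d := d) hJ
  let T : periodicGrid d J →ₗ[ℝ] periodicGrid d J :=
    { toFun v := ⟨fun j => w j • v.1 j - (2⁻¹ : ℝ) • (deltaM h v.1 (j + 1) - deltaM h v.1 j),
        fun j => by
          have hD := deltaM_periodic hper v.2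
          have e : j + (J : ℤ) + 1 = j + 1 + J := by ring
          simp only [e, hwper j, v.2 j, hD j, hD (j + 1)]⟩
      map_add' u v := Subtype.ext (funext fun j => by
        simp only [Submodule.coe_add, Pi.add_apply, deltaM_add]
        module)
      map_smul' c v := Subtype.ext (funext fun j => by
        simp only [Submodule.coe_smul, Pi.smul_apply, deltaM_smul, RingHom.id_apply]
        module) }
  have hinj : Function.Injective T := by
    refine (injective_iff_map_eq_zero T).2 fun v hv => Subtype.ext ?_
    exact eq_zero_of_homogeneous hJ hpos hper hw hw' v.2
      fun j => congrFun (congrArg Subtype.val hv) j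
  obtain ⟨v, hv⟩ := LinearMap.injective_iff_surjective.1 hinj ⟨f, hf⟩
  refine ⟨v.1, ⟨v.2, fun j => congrFun (congrArg Subtype.val hv) j⟩, fun u ⟨hu, hu'⟩ => ?_⟩
  have huv : T ⟨u, hu⟩ = T v := hv ▸ Subtype.ext (funext hu')
  exact congrArg Subtype.val (hinj huv)

end

/-- Well-posedness of the Crank–Nicolson-type corrector step for curve shortening flow:
if `δ⁻x^m_j ≠ 0` for all `j` and `x^{m+1/2}` is the solution of the predictor equations,
then there is exactly one (J-periodic) grid function `x^{m+1}` satisfying the corrector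
equations. -/
theorem corrector_well_posed
    (d : ℕ) (hd : 2 ≤ d) (J : ℕ) (hJ : 3 ≤ J)
    (ρ : ℤ → ℝ) (hmono : StrictMono ρ) (hρ0 : ρ 0 = 0)
    (hρper : ∀ j : ℤ, ρ (j + (J : ℤ)) = ρ j + 1)
    (h : ℤ → ℝ) (hh : ∀ j : ℤ, h j = ρ j - ρ (j - 1))
    (Δt : ℝ) (hΔt : 0 < Δt)
    (xm : ℤ → EuclideanSpace ℝ (Fin d))
    (hxm : ∀ j : ℤ, xm (j + (J : ℤ)) = xm j)
    (hnz : ∀ j : ℤ, deltaM h xm j ≠ 0)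
    (xh : ℤ → EuclideanSpace ℝ (Fin d))
    (hxh : ∀ j : ℤ, xh (j + (J : ℤ)) = xh j)
    (hpred : ∀ j : ℤ,
      xh j - xm j
        - (Δt * ((h j + h (j + 1)) / 2 /
            (h j * ‖deltaM h xm j‖ ^ 2 + h (j + 1) * ‖deltaM h xm (j + 1)‖ ^ 2))) •
          delta2 h xh j = 0) :
    ∃! xp : ℤ → EuclideanSpace ℝ (Fin d),
      (∀ j : ℤ, xp (j + (J : ℤ)) = xp j) ∧
      ∀ j : ℤ,
        ((h j * ‖deltaM h xh j‖ ^ 2 + h (j + 1) * ‖deltaM h xh (j + 1)‖ ^ 2) / 2) •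
            (Δt⁻¹ • (xp j - xm j))
          - (2⁻¹ : ℝ) •
              ((deltaP h xp j - deltaM h xp j) + (deltaP h xm j - deltaM h xm j)) = 0 := by
  have hJ0 : 0 < J := by omega
  have hpos : ∀ j, 0 < h j := fun j => by
    rw [hh, sub_pos]
    exact hmono (by omega)
  have hper : Function.Periodic h (J : ℤ) := fun j => by
    have e : j + (J : ℤ) - 1 = j - 1 + J := by ring
    rw [hh, hh, e, hρper, hρper]
    ring
  have hDm := deltaM_periodic hper hxm
  have hDh := deltaM_periodic hper hxh
  have hshift : ∀ j : ℤ, j + (J : ℤ) + 1 = j + 1 + J := fun j => by ring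
  obtain ⟨k, hk⟩ : ∃ k, deltaM h xh k ≠ 0 := by
    by_contra! hzero
    have hxeq : xh = xm := funext fun j => by
      have := hpred j
      simpa [delta2, deltaP_eq_deltaM_succ, hzero, sub_eq_zero] using this
    exact hnz 0 (hxeq ▸ hzero 0)
  let w : ℤ → ℝ := fun j =>
    (h j * ‖deltaM h xh j‖ ^ 2 + h (j + 1) * ‖deltaM h xh (j + 1)‖ ^ 2) / 2 * Δt⁻¹
  have hw : ∀ j, 0 ≤ w j := fun j => by
    have := hpos j
    have := hpos (j + 1)
    positivity
  have hw' : ∃ j, 0 < w j := ⟨k, by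
    have := hpos k
    have := hpos (k + 1)
    have := norm_pos_iff.2 hk
    positivity⟩
  have hwper : Function.Periodic w (J : ℤ) := fun j => by
    simp only [w, hshift, hper j, hper (j + 1), hDh j, hDh (j + 1)]
  have hf : Function.Periodic
      (fun j => w j • xm j + (2⁻¹ : ℝ) • (deltaM h xm (j + 1) - deltaM h xm j)) (J : ℤ) :=
    fun j => by simp only [hshift, hwper j, hxm j, hDm j, hDm (j + 1)]
  refine (existsUnique_congr fun xp => and_congr Iff.rfl (forall_congr' fun j => ?_)).1
    (existsUnique_periodic_solution hJ0 hpos hper hw hw' hwper hf)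
  rw [← sub_eq_zero, deltaP_eq_deltaM_succ, deltaP_eq_deltaM_succ, smul_smul]
  refine Eq.congr ?_ rfl
  simp only [w]
  module
end
end

section
/- Let Δt > 0 and let x^m_h, x^{m+1/2}_h, z^{m+1/2}_h ∈ V^h be given, and assume the piecewise constant derivative x^{m+1/2}_{h,ρ} is nonzero on every element [ρ_{j−1}, ρ_j], j = 1,…,J. Then there exists exactly one pair (x^{m+1}_h, y^{m+1/2}_h) ∈ V^h × V^h satisfying the curve diffusion corrector equations: for all χ ∈ V^h, ∫₀¹ ((x^{m+1}_h − x^m_h)/Δt)·χ |x^{m+1/2}_{h,ρ}|² dρ − ∫₀¹ y^{m+1/2}_{h,ρ}·χ_ρ dρ = 2∫₀¹ (y^{m+1/2}_{h,ρ}·x^{m+1/2}_{h,ρ})(z^{m+1/2}_h·χ) dρ + ∫₀¹ (z^{m+1/2}_h·y^{m+1/2}_h)(z^{m+1/2}_h·χ) |x^{m+1/2}_{h,ρ}|² dρ + ∫₀¹ (F₂(x^{m+1/2}_{h,ρ}, z^{m+1/2}_h, z^{m+1/2}_{h,ρ}) y^{m+1/2}_h)·χ dρ, and for all η ∈ V^h,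 ∫₀¹ y^{m+1/2}_h·η |x^{m+1/2}_{h,ρ}|² dρ + ½∫₀¹ x^{m+1}_{h,ρ}·η_ρ dρ = −½∫₀¹ x^m_{h,ρ}·η_ρ dρ. -/
open scoped BigOperators RealInnerProductSpace

noncomputable section

/-- The space `V^h` of continuous, 1-periodic, piecewise affine (with respect to the
partition `ρ`) vector-valued finite element functions. -/
def Vh (d J : ℕ) (ρ : ℤ → ℝ) : Set (ℝ → EuclideanSpace ℝ (Fin d)) :=
  {u | Continuous u ∧ (∀ θ : ℝ, u (θ + 1) = u θ) ∧
    ∀ j : ℤ, ∃ a b : EuclideanSpace ℝ (Fin d),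
      ∀ θ ∈ Set.Icc (ρ (j - 1)) (ρ j), u θ = a + θ • b}

/-- `F₂(a,b,c)w` where `F₂(a,b,c) = 2(c⊗a − a⊗c) + 2(a·b)(a⊗b − b⊗a)` and
`(u⊗v)w = (v·w)u`. -/
def F2app {d : ℕ} (a b c w : EuclideanSpace ℝ (Fin d)) : EuclideanSpace ℝ (Fin d) :=
  (2 : ℝ) • (⟪a, w⟫ • c - ⟪c, w⟫ • a) + (2 * ⟪a, b⟫) • (⟪b, w⟫ • a - ⟪a, w⟫ • b)

open MeasureTheory

section Partition

variable {J : ℕ} {ρ : ℤ → ℝ}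

lemma partition_add_int_mul (hρper : ∀ j : ℤ, ρ (j + (J : ℤ)) = ρ j + 1) (j n : ℤ) :
    ρ (j + n * J) = ρ j + n := by
  induction n using Int.induction_on with
  | zero => simp
  | succ k ih =>
    have h := hρper (j + k * J)
    rw [show j + ((k : ℤ) + 1) * J = j + k * J + J by ring, h, ih]
    push_cast
    ring
  | pred k ih =>
    have h := hρper (j + (-(k : ℤ) - 1) * J)
    rw [show j + (-(k : ℤ) - 1) * J + J = j + -(k : ℤ) * J by ring, ih] at h
    push_cast at h ⊢
    linarith

/-- The elements of a periodic partition cover the real line. -/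
lemma exists_mem_Ioc_partition (hmono : StrictMono ρ) (hρ0 : ρ 0 = 0)
    (hρper : ∀ j : ℤ, ρ (j + (J : ℤ)) = ρ j + 1) (θ : ℝ) :
    ∃ j : ℤ, θ ∈ Set.Ioc (ρ (j - 1)) (ρ j) := by
  have hint : ∀ n : ℤ, ρ (n * J) = n := fun n => by
    simpa [hρ0] using partition_add_int_mul hρper 0 n
  obtain ⟨j, hj, hmin⟩ := Int.exists_least_of_bdd (P := fun j => θ ≤ ρ j)
    ⟨⌊θ⌋ * J, fun j hj => by
      by_contra! hlt
      have h := hmono hlt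
      rw [hint] at h
      linarith [Int.floor_le θ]⟩
    ⟨⌈θ⌉ * J, by rw [hint]; exact Int.le_ceil θ⟩
  refine ⟨j, ?_, hj⟩
  by_contra! h
  have := hmin _ h
  omega

/-- Almost every point lies in the interior of an element. -/
lemma ae_mem_Ioo_partition (hmono : StrictMono ρ) (hρ0 : ρ 0 = 0)
    (hρper : ∀ j : ℤ, ρ (j + (J : ℤ)) = ρ j + 1) :
    ∀ᵐ θ : ℝ, ∃ j : ℤ, θ ∈ Set.Ioo (ρ (j - 1)) (ρ j) := by
  filter_upwards [(Set.countable_range ρ).ae_notMem volume] with θ hθ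
  obtain ⟨j, h₁, h₂⟩ := exists_mem_Ioc_partition hmono hρ0 hρper θ
  exact ⟨j, h₁, h₂.lt_of_ne fun h => hθ ⟨j, h.symm⟩⟩

/-- `f` agrees with a continuous function in the interior of each element. -/
def PiecewiseContinuous {F : Type*} [TopologicalSpace F] (ρ : ℤ → ℝ) (f : ℝ → F) : Prop :=
  ∀ j : ℤ, ∃ g : ℝ → F, Continuous g ∧ Set.EqOn f g (Set.Ioo (ρ (j - 1)) (ρ j))

namespace PiecewiseContinuous

variable {F G : Type*} [TopologicalSpace F] [TopologicalSpace G]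

lemma prodMk {f : ℝ → F} {g : ℝ → G} (hf : PiecewiseContinuous ρ f)
    (hg : PiecewiseContinuous ρ g) : PiecewiseContinuous ρ fun θ => (f θ, g θ) := fun j => by
  obtain ⟨f', hf', hff'⟩ := hf j
  obtain ⟨g', hg', hgg'⟩ := hg j
  exact ⟨fun θ => (f' θ, g' θ), by fun_prop, fun θ hθ => by simp [hff' hθ, hgg' hθ]⟩

lemma comp {φ : F → G} (hφ : Continuous φ) {f : ℝ → F} (hf : PiecewiseContinuous ρ f) :
    PiecewiseContinuous ρ fun θ => φ (f θ) := fun j => by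
  obtain ⟨f', hf', hff'⟩ := hf j
  exact ⟨fun θ => φ (f' θ), by fun_prop, fun θ hθ => by simp [hff' hθ]⟩

lemma mul {f g : ℝ → ℝ} (hf : PiecewiseContinuous ρ f) (hg : PiecewiseContinuous ρ g) :
    PiecewiseContinuous ρ fun θ => f θ * g θ :=
  (hf.prodMk hg).comp continuous_mul

lemma inner {E : Type*} [NormedAddCommGroup E] [InnerProductSpace ℝ E] {f g : ℝ → E}
    (hf : PiecewiseContinuous ρ f) (hg : PiecewiseContinuous ρ g) :
    PiecewiseContinuous ρ fun θ => ⟪f θ, g θ⟫ :=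
  (hf.prodMk hg).comp continuous_inner

lemma norm_sq {E : Type*} [NormedAddCommGroup E] {f : ℝ → E} (hf : PiecewiseContinuous ρ f) :
    PiecewiseContinuous ρ fun θ => ‖f θ‖ ^ 2 :=
  hf.comp (continuous_norm.pow 2)

lemma intervalIntegrable (hmono : StrictMono ρ) (hρ0 : ρ 0 = 0)
    (hρper : ∀ j : ℤ, ρ (j + (J : ℤ)) = ρ j + 1) {f : ℝ → ℝ} (hf : PiecewiseContinuous ρ f) :
    IntervalIntegrable f volume 0 1 := by
  have h : IntervalIntegrable f volume (ρ ((0 : ℕ) : ℤ)) (ρ (J : ℤ)) := by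
    refine IntervalIntegrable.trans_iterate (a := fun n : ℕ => ρ n) fun k _ => ?_
    obtain ⟨g, hg, hfg⟩ := hf (k + 1)
    simp only [add_sub_cancel_right] at hfg
    have hle : ρ k ≤ ρ (k + 1) := hmono.monotone (by omega)
    have hgi : IntervalIntegrable g volume (ρ k) (ρ (k + 1)) := hg.intervalIntegrable _ _
    push_cast
    rw [intervalIntegrable_iff_integrableOn_Ioo_of_le hle] at hgi ⊢
    exact hgi.congr_fun hfg.symm measurableSet_Ioo
  have h1 : ρ J = 1 := by simpa [hρ0] using hρper 0
  simpa [hρ0, h1] using h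

end PiecewiseContinuous

end Partition

section FiniteElement

variable {d J : ℕ} {ρ : ℤ → ℝ}

/-- `Vh` as a vector space. -/
def VhSubmodule (d J : ℕ) (ρ : ℤ → ℝ) : Submodule ℝ (ℝ → EuclideanSpace ℝ (Fin d)) where
  carrier := Vh d J ρ
  zero_mem' := ⟨continuous_const, fun _ => rfl, fun _ => ⟨0, 0, fun _ _ => by simp⟩⟩
  add_mem' := by
    rintro u v ⟨huc, hup, hua⟩ ⟨hvc, hvp, hva⟩
    refine ⟨huc.add hvc, fun θ => by simp [hup, hvp], fun j => ?_⟩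
    obtain ⟨a, b, h⟩ := hua j
    obtain ⟨a', b', h'⟩ := hva j
    refine ⟨a + a', b + b', fun θ hθ => ?_⟩
    simp only [Pi.add_apply, h θ hθ, h' θ hθ]
    module
  smul_mem' := by
    rintro c u ⟨huc, hup, hua⟩
    refine ⟨huc.const_smul c, fun θ => by simp [hup], fun j => ?_⟩
    obtain ⟨a, b, h⟩ := hua j
    refine ⟨c • a, c • b, fun θ hθ => ?_⟩
    simp only [Pi.smul_apply, h θ hθ]
    module

namespace Vh

variable {u : ℝ → EuclideanSpace ℝ (Fin d)}

lemma exists_hasDerivAt (hu : u ∈ Vh d J ρ) (j : ℤ) :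
    ∃ b, ∀ θ ∈ Set.Ioo (ρ (j - 1)) (ρ j), HasDerivAt u b θ := by
  obtain ⟨a, b, h⟩ := hu.2.2 j
  refine ⟨b, fun θ hθ => ?_⟩
  have h₁ : HasDerivAt (fun t : ℝ => a + t • b) b θ := by
    simpa using ((hasDerivAt_id θ).smul_const b).const_add a
  refine h₁.congr_of_eventuallyEq ?_
  filter_upwards [Ioo_mem_nhds hθ.1 hθ.2] with t ht using h t (Set.Ioo_subset_Icc_self ht)

lemma ae_differentiableAt (hmono : StrictMono ρ) (hρ0 : ρ 0 = 0)
    (hρper : ∀ j : ℤ, ρ (j + (J : ℤ)) = ρ j + 1) (hu : u ∈ Vh d J ρ) :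
    ∀ᵐ θ : ℝ, DifferentiableAt ℝ u θ := by
  filter_upwards [ae_mem_Ioo_partition hmono hρ0 hρper] with θ ⟨j, hj⟩
  obtain ⟨b, hb⟩ := exists_hasDerivAt hu j
  exact (hb θ hj).differentiableAt

lemma piecewiseContinuous (hu : u ∈ Vh d J ρ) : PiecewiseContinuous ρ u :=
  fun _ => ⟨u, hu.1, fun _ _ => rfl⟩

lemma piecewiseContinuous_deriv (hu : u ∈ Vh d J ρ) : PiecewiseContinuous ρ (deriv u) := fun j => by
  obtain ⟨b, hb⟩ := exists_hasDerivAt hu j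
  exact ⟨fun _ => b, continuous_const, fun θ hθ => (hb θ hθ).deriv⟩

/-- A finite element function vanishing almost everywhere on one period is zero. -/
lemma eq_zero_of_ae (hu : u ∈ Vh d J ρ)
    (h : ∀ᵐ θ ∂volume.restrict (Set.Ioc (0 : ℝ) 1), u θ = 0) : u = 0 := by
  have hIcc : Set.EqOn u 0 (Set.Icc 0 1) := by
    refine Measure.eqOn_Icc_of_ae_eq volume zero_ne_one ?_ hu.1.continuousOn continuousOn_const
    rwa [Measure.restrict_congr_set Ioc_ae_eq_Icc.symm]
  funext θ
  have hper : Function.Periodic u 1 := hu.2.1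
  obtain ⟨t, ht, h⟩ := hper.exists_mem_Ico₀ one_pos θ
  rw [h]
  exact hIcc (Set.Ico_subset_Icc_self ht)

/-- A finite element function vanishing at the nodes of one period is zero. -/
lemma eq_zero_of_nodes (hmono : StrictMono ρ) (hρ0 : ρ 0 = 0)
    (hρper : ∀ j : ℤ, ρ (j + (J : ℤ)) = ρ j + 1) (hJ : 0 < J) (hu : u ∈ Vh d J ρ)
    (h : ∀ k : Fin J, u (ρ (k : ℕ)) = 0) : u = 0 := by
  have hper : Function.Periodic u 1 := hu.2.1
  have hnode : ∀ j : ℤ, u (ρ j) = 0 := fun j => by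
    have hpos : 0 ≤ j % J := Int.emod_nonneg _ (by omega)
    have hlt : j % J < J := Int.emod_lt_of_pos _ (by omega)
    have hk := h ⟨(j % J).toNat, by omega⟩
    simp only [Int.toNat_of_nonneg hpos] at hk
    have hj := partition_add_int_mul hρper (j % J) (j / J)
    rw [Int.emod_add_ediv_mul] at hj
    rw [hj, ← hk]
    simpa using hper.int_mul (j / J) (ρ (j % J))
  funext θ
  obtain ⟨j, hj⟩ := exists_mem_Ioc_partition hmono hρ0 hρper θ
  obtain ⟨a, b, hab⟩ := hu.2.2 j
  have hlt : ρ (j - 1) < ρ j := hmono (by omega)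
  have h₁ := hab _ (Set.left_mem_Icc.2 hlt.le)
  have h₂ := hab _ (Set.right_mem_Icc.2 hlt.le)
  rw [hnode] at h₁ h₂
  have hb : b = 0 := by
    have : (ρ j - ρ (j - 1)) • b = 0 := by
      rw [sub_smul, sub_eq_zero]
      exact add_left_cancel (h₂.symm.trans h₁)
    exact (smul_eq_zero.1 this).resolve_left (sub_pos.2 hlt).ne'
  subst hb
  rw [hab θ (Set.Ioc_subset_Icc_self hj), smul_zero]
  simpa using h₁.symm

end Vh

lemma finiteDimensional_VhSubmodule (hmono : StrictMono ρ) (hρ0 : ρ 0 = 0)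
    (hρper : ∀ j : ℤ, ρ (j + (J : ℤ)) = ρ j + 1) (hJ : 0 < J) :
    FiniteDimensional ℝ (VhSubmodule d J ρ) := by
  let ev : VhSubmodule d J ρ →ₗ[ℝ] (Fin J → EuclideanSpace ℝ (Fin d)) :=
    (LinearMap.pi fun k : Fin J => LinearMap.proj (ρ (k : ℕ))) ∘ₗ (VhSubmodule d J ρ).subtype
  refine FiniteDimensional.of_injective ev ((injective_iff_map_eq_zero ev).2 fun u hu => ?_)
  exact Subtype.ext (Vh.eq_zero_of_nodes hmono hρ0 hρper hJ u.2 fun k => congrFun hu k)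

end FiniteElement

section Forms

variable {d J : ℕ} {ρ : ℤ → ℝ}

/-- A finite-dimensional linear system given by two bilinear forms that is injective is uniquely
solvable. -/
lemma existsUnique_of_forms {W : Type*} [AddCommGroup W] [Module ℝ W] [FiniteDimensional ℝ W]
    (A C : W × W →ₗ[ℝ] W →ₗ[ℝ] ℝ) (hinj : ∀ p, A p = 0 → C p = 0 → p = 0)
    (f g : W →ₗ[ℝ] ℝ) : ∃! p, A p = f ∧ C p = g := by
  have hL : Function.Injective (A.prod C) := by
    refine (injective_iff_map_eq_zero _).2 fun p hp => ?_
    exact hinj p (congrArg Prod.fst hp) (congrArg Prod.snd hp)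
  have hdim : Module.finrank ℝ (W × W) = Module.finrank ℝ ((W →ₗ[ℝ] ℝ) × (W →ₗ[ℝ] ℝ)) := by
    have h : Module.finrank ℝ (W →ₗ[ℝ] ℝ) = Module.finrank ℝ W := Subspace.dual_finrank_eq
    rw [Module.finrank_prod, Module.finrank_prod, h]
  obtain ⟨p, hp⟩ := (LinearMap.injective_iff_surjective_of_finrank_eq_finrank hdim).1 hL (f, g)
  refine ⟨p, ⟨congrArg Prod.fst hp, congrArg Prod.snd hp⟩, fun q hq => hL ?_⟩
  rw [hp]
  exact Prod.ext hq.1 hq.2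

lemma F2app_add (a b c v w : EuclideanSpace ℝ (Fin d)) :
    F2app a b c (v + w) = F2app a b c v + F2app a b c w := by
  simp only [F2app, inner_add_right]
  module

lemma F2app_smul (a b c : EuclideanSpace ℝ (Fin d)) (r : ℝ)
    (w : EuclideanSpace ℝ (Fin d)) : F2app a b c (r • w) = r • F2app a b c w := by
  simp only [F2app, inner_smul_right]
  module

/-- `F₂(a,b,c)` is skew-symmetric. -/
lemma inner_F2app_self (a b c w : EuclideanSpace ℝ (Fin d)) :
    ⟪F2app a b c w, w⟫ = 0 := by
  simp only [F2app, inner_add_left, inner_sub_left, real_inner_smul_left]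
  ring

lemma PiecewiseContinuous.F2app {a b c w : ℝ → EuclideanSpace ℝ (Fin d)}
    (ha : PiecewiseContinuous ρ a) (hb : PiecewiseContinuous ρ b) (hc : PiecewiseContinuous ρ c)
    (hw : PiecewiseContinuous ρ w) :
    PiecewiseContinuous ρ fun θ => F2app (a θ) (b θ) (c θ) (w θ) := by
  let φ : EuclideanSpace ℝ (Fin d) × EuclideanSpace ℝ (Fin d) × EuclideanSpace ℝ (Fin d) ×
      EuclideanSpace ℝ (Fin d) → EuclideanSpace ℝ (Fin d) :=
    fun p => _root_.F2app p.1 p.2.1 p.2.2.1 p.2.2.2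
  have hφ : Continuous φ := by
    unfold φ _root_.F2app
    fun_prop
  exact (ha.prodMk (hb.prodMk (hc.prodMk hw))).comp hφ

lemma intervalIntegral_add_of_ae {f g h : ℝ → ℝ} (hg : IntervalIntegrable g volume 0 1)
    (hh : IntervalIntegrable h volume 0 1) (hf : ∀ᵐ θ : ℝ, f θ = g θ + h θ) :
    ∫ θ in (0 : ℝ)..1, f θ = (∫ θ in (0 : ℝ)..1, g θ) + ∫ θ in (0 : ℝ)..1, h θ := by
  rw [← intervalIntegral.integral_add hg hh]
  exact intervalIntegral.integral_congr_ae (hf.mono fun θ h _ => h)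

lemma intervalIntegral_smul_of_ae {f g : ℝ → ℝ} (c : ℝ) (hf : ∀ᵐ θ : ℝ, f θ = c * g θ) :
    ∫ θ in (0 : ℝ)..1, f θ = c * ∫ θ in (0 : ℝ)..1, g θ := by
  rw [← intervalIntegral.integral_const_mul]
  exact intervalIntegral.integral_congr_ae (hf.mono fun θ h _ => h)

lemma ae_eq_zero_of_intervalIntegral_eq_zero {f : ℝ → ℝ} (hf : IntervalIntegrable f volume 0 1)
    (hnn : ∀ θ, 0 ≤ f θ) (h : ∫ θ in (0 : ℝ)..1, f θ = 0) :
    ∀ᵐ θ ∂volume.restrict (Set.Ioc (0 : ℝ) 1), f θ = 0 :=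
  (intervalIntegral.integral_eq_zero_iff_of_le_of_nonneg_ae zero_le_one
    (Filter.Eventually.of_forall hnn) hf).1 h

/-- Integrand of the first corrector equation, with every term depending linearly on the
unknowns moved to the left-hand side. -/
def positionIntegrand (Δt : ℝ) (xh zh x y χ : ℝ → EuclideanSpace ℝ (Fin d)) (θ : ℝ) : ℝ :=
  Δt⁻¹ * ⟪x θ, χ θ⟫ * ‖deriv xh θ‖ ^ 2 - ⟪deriv y θ, deriv χ θ⟫
    - 2 * (⟪deriv y θ, deriv xh θ⟫ * ⟪zh θ, χ θ⟫)
    - ⟪zh θ, y θ⟫ * ⟪zh θ, χ θ⟫ * ‖deriv xh θ‖ ^ 2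
    - ⟪F2app (deriv xh θ) (zh θ) (deriv zh θ) (y θ), χ θ⟫

/-- Integrand of the left-hand side of the second corrector equation. -/
def curvatureIntegrand (xh x y η : ℝ → EuclideanSpace ℝ (Fin d)) (θ : ℝ) : ℝ :=
  ⟪y θ, η θ⟫ * ‖deriv xh θ‖ ^ 2 + (1 / 2) * ⟪deriv x θ, deriv η θ⟫

variable {Δt : ℝ} {xm xh zh x y χ : ℝ → EuclideanSpace ℝ (Fin d)}

lemma piecewiseContinuous_positionIntegrand (hxh : xh ∈ Vh d J ρ) (hzh : zh ∈ Vh d J ρ)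
    (hx : x ∈ Vh d J ρ) (hy : y ∈ Vh d J ρ) (hχ : χ ∈ Vh d J ρ) :
    PiecewiseContinuous ρ (positionIntegrand Δt xh zh x y χ) := by
  let φ : (EuclideanSpace ℝ (Fin d) × EuclideanSpace ℝ (Fin d) × EuclideanSpace ℝ (Fin d)) ×
      (EuclideanSpace ℝ (Fin d) × EuclideanSpace ℝ (Fin d)) ×
      (EuclideanSpace ℝ (Fin d) × EuclideanSpace ℝ (Fin d) × EuclideanSpace ℝ (Fin d)) → ℝ :=
    fun ((dx, z, dz), (c, dc), (x, y, dy)) =>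
      Δt⁻¹ * ⟪x, c⟫ * ‖dx‖ ^ 2 - ⟪dy, dc⟫ - 2 * (⟪dy, dx⟫ * ⟪z, c⟫)
        - ⟪z, y⟫ * ⟪z, c⟫ * ‖dx‖ ^ 2 - ⟪F2app dx z dz y, c⟫
  have hφ : Continuous φ := by
    unfold φ F2app
    fun_prop
  exact (((Vh.piecewiseContinuous_deriv hxh).prodMk ((Vh.piecewiseContinuous hzh).prodMk
    (Vh.piecewiseContinuous_deriv hzh))).prodMk (((Vh.piecewiseContinuous hχ).prodMk
    (Vh.piecewiseContinuous_deriv hχ)).prodMk ((Vh.piecewiseContinuous hx).prodMk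
    ((Vh.piecewiseContinuous hy).prodMk (Vh.piecewiseContinuous_deriv hy))))).comp hφ

lemma piecewiseContinuous_curvatureIntegrand (hxh : xh ∈ Vh d J ρ)
    (hx : x ∈ Vh d J ρ) (hy : y ∈ Vh d J ρ) (hχ : χ ∈ Vh d J ρ) :
    PiecewiseContinuous ρ (curvatureIntegrand xh x y χ) := by
  let φ : (EuclideanSpace ℝ (Fin d) × EuclideanSpace ℝ (Fin d)) ×
      EuclideanSpace ℝ (Fin d) × EuclideanSpace ℝ (Fin d) × EuclideanSpace ℝ (Fin d) → ℝ :=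
    fun ((dx, y), (c, dc, dX)) => ⟪y, c⟫ * ‖dx‖ ^ 2 + (1 / 2) * ⟪dX, dc⟫
  have hφ : Continuous φ := by
    unfold φ
    fun_prop
  exact (((Vh.piecewiseContinuous_deriv hxh).prodMk (Vh.piecewiseContinuous hy)).prodMk
    ((Vh.piecewiseContinuous hχ).prodMk ((Vh.piecewiseContinuous_deriv hχ).prodMk
    (Vh.piecewiseContinuous_deriv hx)))).comp hφ

lemma exists_positionForm (hmono : StrictMono ρ) (hρ0 : ρ 0 = 0)
    (hρper : ∀ j : ℤ, ρ (j + (J : ℤ)) = ρ j + 1) (hxh : xh ∈ Vh d J ρ) (hzh : zh ∈ Vh d J ρ) :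
    ∃ A : VhSubmodule d J ρ × VhSubmodule d J ρ →ₗ[ℝ] VhSubmodule d J ρ →ₗ[ℝ] ℝ,
      ∀ p χ, A p χ = ∫ θ in (0 : ℝ)..1, positionIntegrand Δt xh zh p.1 p.2 χ θ := by
  have hint (p : VhSubmodule d J ρ × VhSubmodule d J ρ) (χ : VhSubmodule d J ρ) :
      IntervalIntegrable (positionIntegrand Δt xh zh p.1 p.2 χ) volume 0 1 :=
    (piecewiseContinuous_positionIntegrand hxh hzh p.1.2 p.2.2 χ.2).intervalIntegrable
      hmono hρ0 hρper
  have hdiff (u : VhSubmodule d J ρ) : ∀ᵐ θ : ℝ, DifferentiableAt ℝ u.1 θ :=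
    Vh.ae_differentiableAt hmono hρ0 hρper u.2
  refine ⟨LinearMap.mk₂ ℝ
    (fun p χ => ∫ θ in (0 : ℝ)..1, positionIntegrand Δt xh zh p.1 p.2 χ θ) ?_ ?_ ?_ ?_,
    fun _ _ => rfl⟩
  · intro p q χ
    refine intervalIntegral_add_of_ae (hint p χ) (hint q χ) ?_
    filter_upwards [hdiff p.2, hdiff q.2] with θ hp hq
    simp only [positionIntegrand, Prod.fst_add, Prod.snd_add, Submodule.coe_add, Pi.add_apply,
      deriv_add hp hq, F2app_add, inner_add_left, inner_add_right]
    ring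
  · intro c p χ
    refine intervalIntegral_smul_of_ae c ?_
    filter_upwards [hdiff p.2] with θ hp
    simp only [positionIntegrand, Prod.smul_fst, Prod.smul_snd, Submodule.coe_smul, Pi.smul_apply,
      deriv_const_smul c hp, F2app_smul, real_inner_smul_left, real_inner_smul_right]
    ring
  · intro p χ ψ
    refine intervalIntegral_add_of_ae (hint p χ) (hint p ψ) ?_
    filter_upwards [hdiff χ, hdiff ψ] with θ hp hq
    simp only [positionIntegrand, Submodule.coe_add, Pi.add_apply,
      deriv_add hp hq, inner_add_right]
    ring
  · intro c p χ
    refine intervalIntegral_smul_of_ae c ?_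
    filter_upwards [hdiff χ] with θ hp
    simp only [positionIntegrand, Submodule.coe_smul, Pi.smul_apply,
      deriv_const_smul c hp, real_inner_smul_right]
    ring

lemma exists_curvatureForm (hmono : StrictMono ρ) (hρ0 : ρ 0 = 0)
    (hρper : ∀ j : ℤ, ρ (j + (J : ℤ)) = ρ j + 1) (hxh : xh ∈ Vh d J ρ) :
    ∃ C : VhSubmodule d J ρ × VhSubmodule d J ρ →ₗ[ℝ] VhSubmodule d J ρ →ₗ[ℝ] ℝ,
      ∀ p η, C p η = ∫ θ in (0 : ℝ)..1, curvatureIntegrand xh p.1 p.2 η θ := by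
  have hint (p : VhSubmodule d J ρ × VhSubmodule d J ρ) (χ : VhSubmodule d J ρ) :
      IntervalIntegrable (curvatureIntegrand xh p.1 p.2 χ) volume 0 1 :=
    (piecewiseContinuous_curvatureIntegrand hxh p.1.2 p.2.2 χ.2).intervalIntegrable
      hmono hρ0 hρper
  have hdiff (u : VhSubmodule d J ρ) : ∀ᵐ θ : ℝ, DifferentiableAt ℝ u.1 θ :=
    Vh.ae_differentiableAt hmono hρ0 hρper u.2
  refine ⟨LinearMap.mk₂ ℝ
    (fun p η => ∫ θ in (0 : ℝ)..1, curvatureIntegrand xh p.1 p.2 η θ) ?_ ?_ ?_ ?_,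
    fun _ _ => rfl⟩
  · intro p q η
    refine intervalIntegral_add_of_ae (hint p η) (hint q η) ?_
    filter_upwards [hdiff p.1, hdiff q.1] with θ hp hq
    simp only [curvatureIntegrand, Prod.fst_add, Prod.snd_add, Submodule.coe_add, Pi.add_apply,
      deriv_add hp hq, inner_add_left]
    ring
  · intro c p η
    refine intervalIntegral_smul_of_ae c ?_
    filter_upwards [hdiff p.1] with θ hp
    simp only [curvatureIntegrand, Prod.smul_fst, Prod.smul_snd, Submodule.coe_smul,
      Pi.smul_apply, deriv_const_smul c hp, real_inner_smul_left]
    ring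
  · intro p η ψ
    refine intervalIntegral_add_of_ae (hint p η) (hint p ψ) ?_
    filter_upwards [hdiff η, hdiff ψ] with θ hp hq
    simp only [curvatureIntegrand, Submodule.coe_add, Pi.add_apply,
      deriv_add hp hq, inner_add_right]
    ring
  · intro c p η
    refine intervalIntegral_smul_of_ae c ?_
    filter_upwards [hdiff η] with θ hp
    simp only [curvatureIntegrand, Submodule.coe_smul, Pi.smul_apply,
      deriv_const_smul c hp, real_inner_smul_right]
    ring

/-- If the weighted mass of a finite element function vanishes, so does the function. -/
lemma eq_zero_of_integral_mass_eq_zero (hmono : StrictMono ρ) (hρ0 : ρ 0 = 0)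
    (hρper : ∀ j : ℤ, ρ (j + (J : ℤ)) = ρ j + 1) (hxh : xh ∈ Vh d J ρ)
    (hnz : ∀ j : ℤ, ∀ θ ∈ Set.Ioo (ρ (j - 1)) (ρ j), deriv xh θ ≠ 0) (hx : x ∈ Vh d J ρ)
    (h : ∫ θ in (0 : ℝ)..1, ‖x θ‖ ^ 2 * ‖deriv xh θ‖ ^ 2 = 0) : x = 0 := by
  have hpc : PiecewiseContinuous ρ fun θ => ‖x θ‖ ^ 2 * ‖deriv xh θ‖ ^ 2 :=
    (Vh.piecewiseContinuous hx).norm_sq.mul (Vh.piecewiseContinuous_deriv hxh).norm_sq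
  refine Vh.eq_zero_of_ae hx ?_
  filter_upwards [ae_eq_zero_of_intervalIntegral_eq_zero
    (hpc.intervalIntegrable hmono hρ0 hρper) (fun θ => by positivity) h,
    ae_restrict_of_ae (ae_mem_Ioo_partition hmono hρ0 hρper)] with θ hθ ⟨j, hj⟩
  simpa [hnz j θ hj] using hθ

/-- The homogeneous corrector system has only the trivial solution. -/
lemma eq_zero_of_homogeneous_s8 (hmono : StrictMono ρ) (hρ0 : ρ 0 = 0)
    (hρper : ∀ j : ℤ, ρ (j + (J : ℤ)) = ρ j + 1) (hΔt : 0 < Δt)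
    (hxh : xh ∈ Vh d J ρ) (hzh : zh ∈ Vh d J ρ)
    (hnz : ∀ j : ℤ, ∀ θ ∈ Set.Ioo (ρ (j - 1)) (ρ j), deriv xh θ ≠ 0)
    (hx : x ∈ Vh d J ρ) (hy : y ∈ Vh d J ρ)
    (hA : ∀ χ ∈ Vh d J ρ, ∫ θ in (0 : ℝ)..1, positionIntegrand Δt xh zh x y χ θ = 0)
    (hC : ∀ η ∈ Vh d J ρ, ∫ θ in (0 : ℝ)..1, curvatureIntegrand xh x y η θ = 0) :
    x = 0 ∧ y = 0 := by
  have hAint : IntervalIntegrable (positionIntegrand Δt xh zh x y y) volume 0 1 :=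
    (piecewiseContinuous_positionIntegrand hxh hzh hx hy hy).intervalIntegrable hmono hρ0 hρper
  have hCint : IntervalIntegrable (curvatureIntegrand xh x y x) volume 0 1 :=
    (piecewiseContinuous_curvatureIntegrand hxh hx hy hx).intervalIntegrable hmono hρ0 hρper
  have henergy : ∀ θ, Δt⁻¹ * curvatureIntegrand xh x y x θ - positionIntegrand Δt xh zh x y y θ
      = ‖deriv y θ + ⟪zh θ, y θ⟫ • deriv xh θ‖ ^ 2 + Δt⁻¹ / 2 * ‖deriv x θ‖ ^ 2 := fun θ => by
    rw [norm_add_sq_real, norm_smul, mul_pow, Real.norm_eq_abs, sq_abs, real_inner_smul_right]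
    simp only [curvatureIntegrand, positionIntegrand, inner_F2app_self,
      real_inner_self_eq_norm_sq, real_inner_comm (x θ) (y θ)]
    ring
  have hderiv : ∀ᵐ θ ∂volume.restrict (Set.Ioc (0 : ℝ) 1), deriv x θ = 0 := by
    have h := ae_eq_zero_of_intervalIntegral_eq_zero ((hCint.const_mul Δt⁻¹).sub hAint)
      (fun θ => by rw [henergy]; positivity) (by
        rw [intervalIntegral.integral_sub (hCint.const_mul Δt⁻¹) hAint,
          intervalIntegral.integral_const_mul, hC x hx, hA y hy]
        simp)
    filter_upwards [h] with θ hθ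
    rw [henergy] at hθ
    have h₁ : 0 ≤ ‖deriv y θ + ⟪zh θ, y θ⟫ • deriv xh θ‖ ^ 2 := by positivity
    have h₂ : 0 ≤ Δt⁻¹ / 2 * ‖deriv x θ‖ ^ 2 := by positivity
    have h₃ : Δt⁻¹ / 2 * ‖deriv x θ‖ ^ 2 = 0 := by linarith
    simpa [hΔt.ne'] using h₃
  have hy0 : y = 0 := by
    refine eq_zero_of_integral_mass_eq_zero hmono hρ0 hρper hxh hnz hy ?_
    rw [ae_restrict_iff' measurableSet_Ioc] at hderiv
    refine (intervalIntegral.integral_congr_ae ?_).trans (hC y hy)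
    filter_upwards [hderiv] with θ hθ hmem
    rw [Set.uIoc_of_le zero_le_one] at hmem
    simp [curvatureIntegrand, hθ hmem]
  subst hy0
  refine ⟨eq_zero_of_integral_mass_eq_zero hmono hρ0 hρper hxh hnz hx ?_, rfl⟩
  have h := hA x hx
  have hform : ∀ θ, positionIntegrand Δt xh zh x 0 x θ
      = Δt⁻¹ * (‖x θ‖ ^ 2 * ‖deriv xh θ‖ ^ 2) := fun θ => by
    simp [positionIntegrand, F2app, mul_assoc]
  simpa only [hform, intervalIntegral.integral_const_mul, mul_eq_zero, inv_eq_zero, hΔt.ne',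
    false_or] using h

/-- The first corrector equation in terms of `positionIntegrand`. -/
lemma position_equation_iff (hmono : StrictMono ρ) (hρ0 : ρ 0 = 0)
    (hρper : ∀ j : ℤ, ρ (j + (J : ℤ)) = ρ j + 1) (hxm : xm ∈ Vh d J ρ)
    (hxh : xh ∈ Vh d J ρ) (hzh : zh ∈ Vh d J ρ)
    (hx : x ∈ Vh d J ρ) (hy : y ∈ Vh d J ρ) (hχ : χ ∈ Vh d J ρ) :
    (∫ θ in (0 : ℝ)..1, ⟪Δt⁻¹ • (x θ - xm θ), χ θ⟫ * ‖deriv xh θ‖ ^ 2)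
            - ∫ θ in (0 : ℝ)..1, ⟪deriv y θ, deriv χ θ⟫
          = 2 * (∫ θ in (0 : ℝ)..1, ⟪deriv y θ, deriv xh θ⟫ * ⟪zh θ, χ θ⟫)
            + (∫ θ in (0 : ℝ)..1, ⟪zh θ, y θ⟫ * ⟪zh θ, χ θ⟫ * ‖deriv xh θ‖ ^ 2)
            + ∫ θ in (0 : ℝ)..1, ⟪F2app (deriv xh θ) (zh θ) (deriv zh θ) (y θ), χ θ⟫ ↔
      ∫ θ in (0 : ℝ)..1, positionIntegrand Δt xh zh x y χ θ
        = ∫ θ in (0 : ℝ)..1, positionIntegrand Δt xh zh xm 0 χ θ := by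
  have pxh := Vh.piecewiseContinuous_deriv hxh
  have pz := Vh.piecewiseContinuous hzh
  have pz' := Vh.piecewiseContinuous_deriv hzh
  have py := Vh.piecewiseContinuous hy
  have py' := Vh.piecewiseContinuous_deriv hy
  have pχ := Vh.piecewiseContinuous hχ
  have pχ' := Vh.piecewiseContinuous_deriv hχ
  have i₁ : IntervalIntegrable (fun θ => ⟪Δt⁻¹ • (x θ - xm θ), χ θ⟫ * ‖deriv xh θ‖ ^ 2)
      volume 0 1 :=
    ((Vh.piecewiseContinuous (J := J) ((VhSubmodule d J ρ).smul_mem Δt⁻¹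
      ((VhSubmodule d J ρ).sub_mem hx hxm))).inner pχ).mul pxh.norm_sq
      |>.intervalIntegrable hmono hρ0 hρper
  have i₂ : IntervalIntegrable (fun θ => ⟪deriv y θ, deriv χ θ⟫) volume 0 1 :=
    (py'.inner pχ').intervalIntegrable hmono hρ0 hρper
  have i₃ : IntervalIntegrable (fun θ => ⟪deriv y θ, deriv xh θ⟫ * ⟪zh θ, χ θ⟫) volume 0 1 :=
    ((py'.inner pxh).mul (pz.inner pχ)).intervalIntegrable hmono hρ0 hρper
  have i₄ : IntervalIntegrable (fun θ => ⟪zh θ, y θ⟫ * ⟪zh θ, χ θ⟫ * ‖deriv xh θ‖ ^ 2)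
      volume 0 1 :=
    (((pz.inner py).mul (pz.inner pχ)).mul pxh.norm_sq).intervalIntegrable hmono hρ0 hρper
  have i₅ : IntervalIntegrable
      (fun θ => ⟪F2app (deriv xh θ) (zh θ) (deriv zh θ) (y θ), χ θ⟫) volume 0 1 :=
    ((pxh.F2app pz pz' py).inner pχ).intervalIntegrable hmono hρ0 hρper
  have hAx : IntervalIntegrable (positionIntegrand Δt xh zh x y χ) volume 0 1 :=
    (piecewiseContinuous_positionIntegrand hxh hzh hx hy hχ).intervalIntegrable hmono hρ0 hρper
  have hAm : IntervalIntegrable (positionIntegrand Δt xh zh xm 0 χ) volume 0 1 :=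
    (piecewiseContinuous_positionIntegrand hxh hzh hxm (VhSubmodule d J ρ).zero_mem
      hχ).intervalIntegrable hmono hρ0 hρper
  have key : (∫ θ in (0 : ℝ)..1, positionIntegrand Δt xh zh x y χ θ)
      - ∫ θ in (0 : ℝ)..1, positionIntegrand Δt xh zh xm 0 χ θ
      = (∫ θ in (0 : ℝ)..1, ⟪Δt⁻¹ • (x θ - xm θ), χ θ⟫ * ‖deriv xh θ‖ ^ 2)
        - (∫ θ in (0 : ℝ)..1, ⟪deriv y θ, deriv χ θ⟫)
        - 2 * (∫ θ in (0 : ℝ)..1, ⟪deriv y θ, deriv xh θ⟫ * ⟪zh θ, χ θ⟫)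
        - (∫ θ in (0 : ℝ)..1, ⟪zh θ, y θ⟫ * ⟪zh θ, χ θ⟫ * ‖deriv xh θ‖ ^ 2)
        - ∫ θ in (0 : ℝ)..1, ⟪F2app (deriv xh θ) (zh θ) (deriv zh θ) (y θ), χ θ⟫ := by
    rw [← intervalIntegral.integral_const_mul, ← intervalIntegral.integral_sub hAx hAm,
      ← intervalIntegral.integral_sub i₁ i₂,
      ← intervalIntegral.integral_sub (i₁.sub i₂) (i₃.const_mul 2),
      ← intervalIntegral.integral_sub ((i₁.sub i₂).sub (i₃.const_mul 2)) i₄,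
      ← intervalIntegral.integral_sub (((i₁.sub i₂).sub (i₃.const_mul 2)).sub i₄) i₅]
    refine intervalIntegral.integral_congr fun θ _ => ?_
    simp [positionIntegrand, F2app, real_inner_smul_left, inner_sub_left]
    ring
  constructor <;> intro h <;> linarith

/-- The second corrector equation in terms of `curvatureIntegrand`. -/
lemma curvature_equation_iff (hmono : StrictMono ρ) (hρ0 : ρ 0 = 0)
    (hρper : ∀ j : ℤ, ρ (j + (J : ℤ)) = ρ j + 1) (hxh : xh ∈ Vh d J ρ)
    (hx : x ∈ Vh d J ρ) (hy : y ∈ Vh d J ρ) (hχ : χ ∈ Vh d J ρ) :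
    (∫ θ in (0 : ℝ)..1, ⟪y θ, χ θ⟫ * ‖deriv xh θ‖ ^ 2)
            + (1 / 2) * ∫ θ in (0 : ℝ)..1, ⟪deriv x θ, deriv χ θ⟫
          = -((1 / 2) * ∫ θ in (0 : ℝ)..1, ⟪deriv xm θ, deriv χ θ⟫) ↔
      ∫ θ in (0 : ℝ)..1, curvatureIntegrand xh x y χ θ
        = -∫ θ in (0 : ℝ)..1, curvatureIntegrand xh xm 0 χ θ := by
  have i₁ : IntervalIntegrable (fun θ => ⟪y θ, χ θ⟫ * ‖deriv xh θ‖ ^ 2) volume 0 1 :=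
    (((Vh.piecewiseContinuous hy).inner (Vh.piecewiseContinuous hχ)).mul
      (Vh.piecewiseContinuous_deriv hxh).norm_sq).intervalIntegrable hmono hρ0 hρper
  have i₂ : IntervalIntegrable (fun θ => ⟪deriv x θ, deriv χ θ⟫) volume 0 1 :=
    ((Vh.piecewiseContinuous_deriv hx).inner
      (Vh.piecewiseContinuous_deriv hχ)).intervalIntegrable hmono hρ0 hρper
  have h₁ : ∫ θ in (0 : ℝ)..1, curvatureIntegrand xh x y χ θ
      = (∫ θ in (0 : ℝ)..1, ⟪y θ, χ θ⟫ * ‖deriv xh θ‖ ^ 2)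
            + (1 / 2) * ∫ θ in (0 : ℝ)..1, ⟪deriv x θ, deriv χ θ⟫ := by
    rw [← intervalIntegral.integral_const_mul,
      ← intervalIntegral.integral_add i₁ (i₂.const_mul _)]
    rfl
  have h₂ : ∫ θ in (0 : ℝ)..1, curvatureIntegrand xh xm 0 χ θ
      = (1 / 2) * ∫ θ in (0 : ℝ)..1, ⟪deriv xm θ, deriv χ θ⟫ := by
    rw [← intervalIntegral.integral_const_mul]
    simp [curvatureIntegrand]
  rw [h₁, h₂]

end Forms

/-- Well-posedness of the Crank–Nicolson-type corrector step of the second order finite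
element scheme for curve diffusion: if the piecewise constant derivative of `x^{m+1/2}_h`
is nonzero on every element, then there is exactly one pair
`(x^{m+1}_h, y^{m+1/2}_h) ∈ V^h × V^h` solving the corrector equations. -/
theorem cd_corrector_well_posed
    (d : ℕ) (hd : 2 ≤ d) (J : ℕ) (hJ : 3 ≤ J)
    (ρ : ℤ → ℝ) (hmono : StrictMono ρ) (hρ0 : ρ 0 = 0)
    (hρper : ∀ j : ℤ, ρ (j + (J : ℤ)) = ρ j + 1)
    (Δt : ℝ) (hΔt : 0 < Δt)
    (xm xh zh : ℝ → EuclideanSpace ℝ (Fin d))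
    (hxm : xm ∈ Vh d J ρ) (hxh : xh ∈ Vh d J ρ) (hzh : zh ∈ Vh d J ρ)
    (hnz : ∀ j : ℤ, ∀ θ ∈ Set.Ioo (ρ (j - 1)) (ρ j), deriv xh θ ≠ 0) :
    ∃! p : (ℝ → EuclideanSpace ℝ (Fin d)) × (ℝ → EuclideanSpace ℝ (Fin d)),
      p.1 ∈ Vh d J ρ ∧ p.2 ∈ Vh d J ρ ∧
      (∀ χ ∈ Vh d J ρ,
        (∫ θ in (0 : ℝ)..1, ⟪Δt⁻¹ • (p.1 θ - xm θ), χ θ⟫ * ‖deriv xh θ‖ ^ 2)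
            - ∫ θ in (0 : ℝ)..1, ⟪deriv p.2 θ, deriv χ θ⟫
          = 2 * (∫ θ in (0 : ℝ)..1, ⟪deriv p.2 θ, deriv xh θ⟫ * ⟪zh θ, χ θ⟫)
            + (∫ θ in (0 : ℝ)..1, ⟪zh θ, p.2 θ⟫ * ⟪zh θ, χ θ⟫ * ‖deriv xh θ‖ ^ 2)
            + ∫ θ in (0 : ℝ)..1, ⟪F2app (deriv xh θ) (zh θ) (deriv zh θ) (p.2 θ), χ θ⟫) ∧
      (∀ η ∈ Vh d J ρ,
        (∫ θ in (0 : ℝ)..1, ⟪p.2 θ, η θ⟫ * ‖deriv xh θ‖ ^ 2)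
            + (1 / 2) * ∫ θ in (0 : ℝ)..1, ⟪deriv p.1 θ, deriv η θ⟫
          = -((1 / 2) * ∫ θ in (0 : ℝ)..1, ⟪deriv xm θ, deriv η θ⟫)) := by
  obtain ⟨A, hA⟩ := exists_positionForm (Δt := Δt) hmono hρ0 hρper hxh hzh
  obtain ⟨C, hC⟩ := exists_curvatureForm hmono hρ0 hρper hxh
  have := finiteDimensional_VhSubmodule (d := d) hmono hρ0 hρper (by omega)
  let m : VhSubmodule d J ρ × VhSubmodule d J ρ := (⟨xm, hxm⟩, 0)
  obtain ⟨p, hp, huniq⟩ := existsUnique_of_forms A C (fun p hpA hpC => by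
    obtain ⟨h₁, h₂⟩ := eq_zero_of_homogeneous_s8 hmono hρ0 hρper hΔt hxh hzh hnz p.1.2 p.2.2
      (fun χ hχ => by rw [← hA p ⟨χ, hχ⟩, hpA]; rfl)
      (fun χ hχ => by rw [← hC p ⟨χ, hχ⟩, hpC]; rfl)
    exact Prod.ext (Subtype.ext h₁) (Subtype.ext h₂)) (A m) (-C m)
  refine ⟨(p.1, p.2), ⟨p.1.2, p.2.2, fun χ hχ => ?_, fun η hη => ?_⟩, ?_⟩
  · refine (position_equation_iff hmono hρ0 hρper hxm hxh hzh p.1.2 p.2.2 hχ).2 ?_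
    exact (hA p ⟨χ, hχ⟩).symm.trans ((LinearMap.congr_fun hp.1 _).trans (hA m ⟨χ, hχ⟩))
  · refine (curvature_equation_iff hmono hρ0 hρper hxh p.1.2 p.2.2 hη).2 ?_
    exact (hC p ⟨η, hη⟩).symm.trans
      ((LinearMap.congr_fun hp.2 _).trans (congrArg Neg.neg (hC m ⟨η, hη⟩)))
  · rintro ⟨x, y⟩ ⟨hx, hy, h₁, h₂⟩
    let q : VhSubmodule d J ρ × VhSubmodule d J ρ := (⟨x, hx⟩, ⟨y, hy⟩)
    have hq : q = p := huniq q
      ⟨LinearMap.ext fun χ => (hA q χ).trans <|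
        ((position_equation_iff hmono hρ0 hρper hxm hxh hzh hx hy χ.2).1 (h₁ χ χ.2)).trans
          (hA m χ).symm,
      LinearMap.ext fun η => (hC q η).trans <|
        ((curvature_equation_iff hmono hρ0 hρper hxh hx hy η.2).1 (h₂ η η.2)).trans
          (congrArg Neg.neg (hC m η).symm)⟩
    rw [← hq]
end
end

section
/- There exists a constant c > 0 depending only on d, K and ‖u‖_{C³} such that the following holds. Let u : ℝ → ℝ^d be three times continuously differentiable and 1-periodic, and let the partition satisfy the mesh regularity conditions |h_j − h_{j−1}| ≤ K h² and h ≤ K h_j for all j. Then, with q_j = |δ⁻u_j| for the grid function u_j = u(ρ_j), one has | (q_j)² + (q_{j+1})² − 2 |u′(ρ_j)|² | ≤ c h² for all j = 1,…,J. -/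
open scoped BigOperators

noncomputable section

section TaylorBounds

variable {E : Type*} [NormedAddCommGroup E] [NormedSpace ℝ E]

theorem norm_le_mul_abs_pow_succ_of_hasDerivAt {f f' : ℝ → E} {C : ℝ} {n : ℕ} (hC : 0 ≤ C)
    (hf : ∀ t, HasDerivAt f (f' t) t) (h0 : f 0 = 0) (hb : ∀ t, ‖f' t‖ ≤ C * |t| ^ n) (t : ℝ) :
    ‖f t‖ ≤ C * |t| ^ (n + 1) := by
  have key := (convex_Icc (-|t|) |t|).norm_image_sub_le_of_norm_hasDerivWithin_le
    (f := f) (f' := f') (C := C * |t| ^ n) (x := 0) (y := t)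
    (fun s _ => (hf s).hasDerivWithinAt)
    (fun s hs => (hb s).trans (by
      have : |s| ≤ |t| := abs_le.2 hs
      gcongr))
    ⟨by simp, by simp⟩ ⟨neg_abs_le t, le_abs_self t⟩
  simpa [h0, pow_succ, mul_assoc] using key

theorem norm_taylor_one_remainder_le {u u₁ u₂ : ℝ → E} {B : ℝ} (hB : 0 ≤ B)
    (h1 : ∀ t, HasDerivAt u (u₁ t) t) (h2 : ∀ t, HasDerivAt u₁ (u₂ t) t)
    (hb : ∀ t, ‖u₂ t‖ ≤ B) (x t : ℝ) :
    ‖u (x + t) - u x - t • u₁ x‖ ≤ B * |t| ^ 2 := by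
  have b1 : ∀ t, ‖u₁ (x + t) - u₁ x‖ ≤ B * |t| ^ 1 :=
    norm_le_mul_abs_pow_succ_of_hasDerivAt (n := 0) hB
      (fun t => ((h2 (x + t)).comp_const_add x t).sub_const (u₁ x)) (by simp)
      (fun t => by simpa using hb (x + t))
  refine norm_le_mul_abs_pow_succ_of_hasDerivAt (n := 1)
    (f := fun t => u (x + t) - u x - t • u₁ x) hB (fun t => ?_) (by simp) b1 t
  simpa using (((h1 (x + t)).comp_const_add x t).sub_const (u x)).fun_sub
    ((hasDerivAt_id t).smul_const (u₁ x))

theorem norm_taylor_two_remainder_le {u u₁ u₂ u₃ : ℝ → E} {B : ℝ} (hB : 0 ≤ B)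
    (h1 : ∀ t, HasDerivAt u (u₁ t) t) (h2 : ∀ t, HasDerivAt u₁ (u₂ t) t)
    (h3 : ∀ t, HasDerivAt u₂ (u₃ t) t) (hb : ∀ t, ‖u₃ t‖ ≤ B) (x t : ℝ) :
    ‖u (x + t) - u x - t • u₁ x - (t ^ 2 / 2) • u₂ x‖ ≤ B * |t| ^ 3 := by
  refine norm_le_mul_abs_pow_succ_of_hasDerivAt (n := 2)
    (f := fun t => u (x + t) - u x - t • u₁ x - (t ^ 2 / 2) • u₂ x) hB (fun t => ?_) (by simp)
    (norm_taylor_one_remainder_le hB h2 h3 hb x) t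
  have hsq : HasDerivAt (fun t : ℝ => t ^ 2 / 2) t t := by
    simpa using (hasDerivAt_pow 2 t).div_const 2
  simpa using ((((h1 (x + t)).comp_const_add x t).sub_const (u x)).fun_sub
    ((hasDerivAt_id t).smul_const (u₁ x))).fun_sub (hsq.smul_const (u₂ x))

/-- A bound for a difference quotient from a Taylor remainder bound. -/
theorem norm_inv_smul_sub_le {v w : E} {B t : ℝ} {n : ℕ} (ht : t ≠ 0)
    (h : ‖v - t • w‖ ≤ B * |t| ^ (n + 1)) : ‖t⁻¹ • v - w‖ ≤ B * |t| ^ n := by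
  have e : t⁻¹ • v - w = t⁻¹ • (v - t • w) := by
    rw [smul_sub, inv_smul_smul₀ ht]
  rw [e, norm_smul, norm_inv, Real.norm_eq_abs, inv_mul_le_iff₀ (abs_pos.2 ht)]
  calc _ ≤ _ := h
    _ = _ := by ring

end TaylorBounds

theorem abs_norm_sq_add_norm_sq_sub_le {E : Type*} [NormedAddCommGroup E]
    [InnerProductSpace ℝ E] (p q a : E) :
    |‖p‖ ^ 2 + ‖q‖ ^ 2 - 2 * ‖a‖ ^ 2| ≤
      2 * (‖a‖ * ‖(p - a) + (q - a)‖) + ‖p - a‖ ^ 2 + ‖q - a‖ ^ 2 := by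
  have e : ‖p‖ ^ 2 + ‖q‖ ^ 2 - 2 * ‖a‖ ^ 2 =
      2 * inner ℝ a ((p - a) + (q - a)) + ‖p - a‖ ^ 2 + ‖q - a‖ ^ 2 := by
    have hp := norm_add_sq_real a (p - a)
    have hq := norm_add_sq_real a (q - a)
    rw [add_sub_cancel] at hp hq
    rw [inner_add_right]
    linarith
  have hi := abs_le.1 (abs_real_inner_le_norm a ((p - a) + (q - a)))
  rw [e, abs_le]
  constructor <;> nlinarith [sq_nonneg ‖p - a‖, sq_nonneg ‖q - a‖]

/-- Second order consistency of the discrete coefficient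
`(q_j)² + (q_{j+1})²` with `2|u′(ρ_j)|²`, where `q_j = |δ⁻u_j|`, on meshes satisfying
`|h_j − h_{j−1}| ≤ K h²` and `h ≤ K h_j`. -/
theorem discrete_length_consistency
    (d : ℕ) (hd : 1 ≤ d) (K B : ℝ) (hK : 0 < K) (hB : 0 < B) :
    ∃ c : ℝ, 0 < c ∧
      ∀ (J : ℕ), 3 ≤ J →
      ∀ (ρ : ℤ → ℝ), StrictMono ρ → ρ 0 = 0 → (∀ j : ℤ, ρ (j + (J : ℤ)) = ρ j + 1) →
      ∀ (h : ℤ → ℝ), (∀ j : ℤ, h j = ρ j - ρ (j - 1)) →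
      ∀ (hmax : ℝ), (∀ j : ℤ, h j ≤ hmax) → (∃ j : ℤ, h j = hmax) →
      (∀ j : ℤ, |h j - h (j - 1)| ≤ K * hmax ^ 2 ∧ hmax ≤ K * h j) →
      ∀ (u : ℝ → EuclideanSpace ℝ (Fin d)), ContDiff ℝ 3 u → (∀ θ : ℝ, u (θ + 1) = u θ) →
      (∀ k : ℕ, k ≤ 3 → ∀ θ : ℝ, ‖iteratedDeriv k u θ‖ ≤ B) →
      ∀ j : ℤ,
        |‖deltaM h (fun i => u (ρ i)) j‖ ^ 2 + ‖deltaM h (fun i => u (ρ i)) (j + 1)‖ ^ 2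
            - 2 * ‖deriv u (ρ j)‖ ^ 2|
          ≤ c * hmax ^ 2 := by
  refine ⟨B ^ 2 * (K + 6), by positivity, ?_⟩
  intro J _ ρ hρ _ _ h hh H hH _ hreg u hu _ hb j
  have hder : ∀ k : ℕ, k < 3 → ∀ t,
      HasDerivAt (iteratedDeriv k u) (iteratedDeriv (k + 1) u t) t := by
    intro k hk t
    rw [iteratedDeriv_succ]
    exact ((hu.differentiable_iteratedDeriv k (by exact_mod_cast hk)) t).hasDerivAt
  have h1 : ∀ t, HasDerivAt u (deriv u t) t := by
    simpa using hder 0 (by norm_num)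
  have h2 : ∀ t, HasDerivAt (deriv u) (iteratedDeriv 2 u t) t := by
    simpa using hder 1 (by norm_num)
  have h3 := hder 2 (by norm_num)
  have hpos : ∀ i, 0 < h i := fun i => by
    rw [hh]
    exact sub_pos.2 (hρ (by lia))
  have hH0 : 0 ≤ H := (hpos 0).le.trans (hH 0)
  set x := ρ j with hx
  set a := deriv u x with ha
  set b := iteratedDeriv 2 u x with hbd
  -- Both difference quotients have the form `t⁻¹ • (u (x + t) - u x)`, with `t = -h j, h (j + 1)`.
  have quot : ∀ t : ℝ, t ≠ 0 → |t| ≤ H →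
      ‖t⁻¹ • (u (x + t) - u x) - a‖ ≤ B * H ∧
      ‖t⁻¹ • (u (x + t) - u x) - a - (t / 2) • b‖ ≤ B * H ^ 2 := by
    intro t ht htH
    constructor
    · refine (norm_inv_smul_sub_le (n := 1) ht
        (norm_taylor_one_remainder_le hB.le h1 h2 (hb 2 (by norm_num)) x t)).trans ?_
      rw [pow_one]
      gcongr
    · have r := norm_taylor_two_remainder_le hB.le h1 h2 h3 (hb 3 le_rfl) x t
      have e : u (x + t) - u x - t • a - (t ^ 2 / 2) • b
          = (u (x + t) - u x) - t • (a + (t / 2) • b) := by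
        module
      rw [e] at r
      rw [sub_sub]
      refine (norm_inv_smul_sub_le (n := 2) ht r).trans ?_
      gcongr
  have hp : deltaM h (fun i => u (ρ i)) j = (-h j)⁻¹ • (u (x + -h j) - u x) := by
    have : x + -h j = ρ (j - 1) := by rw [hh, hx]; ring
    rw [this, deltaM, inv_neg]
    module
  have hq : deltaM h (fun i => u (ρ i)) (j + 1)
      = (h (j + 1))⁻¹ • (u (x + h (j + 1)) - u x) := by
    have : x + h (j + 1) = ρ (j + 1) := by rw [hh, hx, add_sub_cancel_right]; ring
    rw [this, deltaM, add_sub_cancel_right]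
  obtain ⟨p1, p2⟩ := quot (-h j) (neg_ne_zero.2 (hpos j).ne')
    (by rw [abs_neg, abs_of_pos (hpos j)]; exact hH j)
  obtain ⟨q1, q2⟩ := quot (h (j + 1)) (hpos _).ne'
    (by rw [abs_of_pos (hpos _)]; exact hH _)
  rw [← hp] at p1 p2
  rw [← hq] at q1 q2
  set p := deltaM h (fun i => u (ρ i)) j
  set q := deltaM h (fun i => u (ρ i)) (j + 1)
  have hna : ‖a‖ ≤ B := by simpa using hb 1 (by norm_num) x
  have hnb : ‖b‖ ≤ B := hb 2 (by norm_num) x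
  have hmesh : |h (j + 1) - h j| ≤ K * H ^ 2 := by simpa using (hreg (j + 1)).1
  have hsum : ‖(p - a) + (q - a)‖ ≤ B * H ^ 2 + B * H ^ 2 + K * H ^ 2 / 2 * B := by
    have e : (p - a) + (q - a) = (p - a - (-h j / 2) • b) + (q - a - (h (j + 1) / 2) • b)
        + ((h (j + 1) - h j) / 2) • b := by
      module
    rw [e]
    refine norm_add₃_le.trans (add_le_add (add_le_add p2 q2) ?_)
    rw [norm_smul, Real.norm_eq_abs, abs_div, abs_two]
    gcongr
  calc _ ≤ _ := abs_norm_sq_add_norm_sq_sub_le p q a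
    _ ≤ 2 * (B * (B * H ^ 2 + B * H ^ 2 + K * H ^ 2 / 2 * B)) + (B * H) ^ 2 + (B * H) ^ 2 := by
      gcongr
    _ = _ := by ring
end
end

section
/- There exists a constant c > 0 depending only on d, c₀, C₀, K and ‖u‖_{C³} such that the following holds. Let u : ℝ → ℝ^d be three times continuously differentiable and 1-periodic with c₀ ≤ |u′(ρ)| ≤ C₀ on ℝ (0 < c₀ ≤ C₀), let the partition satisfy the mesh regularity conditions |h_j − h_{j−1}| ≤ K h² and h ≤ K h_j for all j, and let x_h be a grid function satisfying ½c₀ ≤ |δ⁻x_{h,j}| ≤ 2C₀ for all j. Set e_j = x_{h,j} − u(ρ_j), q_{h,j} = |δ⁻x_{h,j}| and α_j = ½(h_j + h_{j+1})/(h_j (q_{h,j})² + h_{j+1} (q_{h,j+1})²). Then for all j = 1,…,J: | α_j − 1/(2|u′(ρ_j)|²) | ≤ c (|δ⁻e_j| + |δ⁻e_{j+1}|) + c h². -/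
open scoped BigOperators

noncomputable section

/-- Integrating a power-type bound on the derivative of a function vanishing at `r`. -/
lemma norm_le_of_hasDerivAt_of_norm_le_pow {E : Type*} [NormedAddCommGroup E] [NormedSpace ℝ E]
    {F F' : ℝ → E} {r M : ℝ} {n : ℕ} (hM : 0 ≤ M) (hF : ∀ s, HasDerivAt F (F' s) s)
    (h0 : F r = 0) (hbound : ∀ s, ‖F' s‖ ≤ M * |s - r| ^ n) (s : ℝ) :
    ‖F s‖ ≤ M * |s - r| ^ (n + 1) := by
  have key := (convex_uIcc r s).norm_image_sub_le_of_norm_hasDerivWithin_le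
    (f := F) (f' := F') (C := M * |s - r| ^ n)
    (fun x _ => (hF x).hasDerivWithinAt)
    (fun x hx => (hbound x).trans (by
      have := Set.abs_sub_left_of_mem_uIcc hx
      gcongr))
    Set.left_mem_uIcc Set.right_mem_uIcc
  rw [h0, sub_zero, Real.norm_eq_abs] at key
  rw [pow_succ, ← mul_assoc]
  exact key

/-- Taylor bounds of orders one, two and three for a `C³` curve with bounded derivatives. -/
lemma taylor_bounds_of_contDiff_three {E : Type*} [NormedAddCommGroup E] [NormedSpace ℝ E]
    {u : ℝ → E} {B : ℝ} (hB : 0 ≤ B) (hu : ContDiff ℝ 3 u)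
    (hbound : ∀ k : ℕ, k ≤ 3 → ∀ θ : ℝ, ‖iteratedDeriv k u θ‖ ≤ B) (r s : ℝ) :
    ‖u s - u r‖ ≤ B * |s - r| ∧
    ‖u s - u r - (s - r) • deriv u r‖ ≤ B * |s - r| ^ 2 ∧
    ‖u s - u r - (s - r) • deriv u r - ((s - r) ^ 2 / 2) • iteratedDeriv 2 u r‖
      ≤ B * |s - r| ^ 3 := by
  have hderiv (k : ℕ) (hk : k < 3) (t : ℝ) :
      HasDerivAt (iteratedDeriv k u) (iteratedDeriv (k + 1) u t) t := by
    rw [iteratedDeriv_succ]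
    exact ((hu.differentiable_iteratedDeriv k (by exact_mod_cast hk)) t).hasDerivAt
  have d0 (t : ℝ) : HasDerivAt u (deriv u t) t := by
    simpa [iteratedDeriv_one] using hderiv 0 (by norm_num) t
  have d1 (t : ℝ) : HasDerivAt (deriv u) (iteratedDeriv 2 u t) t := by
    simpa [iteratedDeriv_one] using hderiv 1 (by norm_num) t
  have lin (v : E) (t : ℝ) : HasDerivAt (fun t : ℝ => (t - r) • v) v t := by
    simpa using ((hasDerivAt_id t).sub_const r).smul_const v
  have quad (v : E) (t : ℝ) :
      HasDerivAt (fun t : ℝ => ((t - r) ^ 2 / 2) • v) ((t - r) • v) t := by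
    have h := (((hasDerivAt_id' t).sub_const r).fun_pow 2).div_const 2
    refine (h.congr_deriv ?_).smul_const v
    norm_num
  have u0 := norm_le_of_hasDerivAt_of_norm_le_pow (n := 0) (r := r) hB
    (fun t => (d0 t).sub_const (u r)) (sub_self _)
    (fun t => by simpa [iteratedDeriv_one] using hbound 1 (by norm_num) t)
  have u1 := norm_le_of_hasDerivAt_of_norm_le_pow (n := 0) (r := r) hB
    (fun t => (d1 t).sub_const (deriv u r)) (sub_self _)
    (fun t => by simpa using hbound 2 (by norm_num) t)
  have u2 := norm_le_of_hasDerivAt_of_norm_le_pow (n := 0) (r := r) hB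
    (fun t => (hderiv 2 (by norm_num) t).sub_const (iteratedDeriv 2 u r)) (sub_self _)
    (fun t => by simpa using hbound 3 le_rfl t)
  have v1 := norm_le_of_hasDerivAt_of_norm_le_pow (r := r) hB
    (fun t => ((d1 t).sub_const (deriv u r)).sub (lin (iteratedDeriv 2 u r) t)) (by simp) u2
  refine ⟨by simpa using u0 s, ?_, ?_⟩
  · exact norm_le_of_hasDerivAt_of_norm_le_pow (r := r) hB
      (fun t => ((d0 t).sub_const (u r)).sub (lin (deriv u r) t)) (by simp) u1 s
  · exact norm_le_of_hasDerivAt_of_norm_le_pow (r := r) hB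
      (fun t => (((d0 t).sub_const (u r)).sub (lin (deriv u r) t)).sub
        (quad (iteratedDeriv 2 u r) t)) (by simp) v1 s

/-- Bounds for the difference quotient of a `C³` curve with signed step `σ`. -/
lemma difference_quotient_bounds {E : Type*} [NormedAddCommGroup E] [NormedSpace ℝ E]
    {u : ℝ → E} {B : ℝ} (hB : 0 ≤ B) (hu : ContDiff ℝ 3 u)
    (hbound : ∀ k : ℕ, k ≤ 3 → ∀ θ : ℝ, ‖iteratedDeriv k u θ‖ ≤ B) (r : ℝ) {σ : ℝ}
    (hσ : σ ≠ 0) :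
    ‖σ⁻¹ • (u (r + σ) - u r)‖ ≤ B ∧
    ‖σ⁻¹ • (u (r + σ) - u r) - deriv u r‖ ≤ B * |σ| ∧
    ‖σ⁻¹ • (u (r + σ) - u r) - deriv u r - (σ / 2) • iteratedDeriv 2 u r‖ ≤ B * σ ^ 2 := by
  obtain ⟨t1, t2, t3⟩ := taylor_bounds_of_contDiff_three hB hu hbound r (r + σ)
  rw [add_sub_cancel_left] at t1 t2 t3
  have hpos : 0 < |σ| := abs_pos.mpr hσ
  have hscale {w : E} {C : ℝ} (hw : ‖w‖ ≤ C * |σ|) : ‖σ⁻¹ • w‖ ≤ C := by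
    rw [norm_smul, norm_inv, Real.norm_eq_abs, inv_mul_le_iff₀ hpos, mul_comm]
    exact hw
  refine ⟨hscale t1, ?_, ?_⟩
  · have := hscale (t2.trans_eq (by ring : _ = B * |σ| * |σ|))
    rwa [smul_sub, inv_smul_smul₀ hσ] at this
  · have := hscale (t3.trans_eq (by rw [← sq_abs σ]; ring : _ = B * σ ^ 2 * |σ|))
    rwa [smul_sub, smul_sub, inv_smul_smul₀ hσ, smul_smul,
      show σ⁻¹ * (σ ^ 2 / 2) = σ / 2 by field_simp] at this

/-- Expansion of the squared length of a perturbation `U` of `p` along `w`, up to second order. -/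
lemma abs_norm_sq_sub_le_of_expansion {E : Type*} [NormedAddCommGroup E] [InnerProductSpace ℝ E]
    {U p w : E} {B σ : ℝ} (hp : ‖p‖ ≤ B) (h1 : ‖U - p‖ ≤ B * |σ|)
    (h2 : ‖U - p - (σ / 2) • w‖ ≤ B * σ ^ 2) :
    |‖U‖ ^ 2 - ‖p‖ ^ 2 - σ * inner ℝ p w| ≤ 3 * B ^ 2 * σ ^ 2 := by
  have expand : ‖U‖ ^ 2 - ‖p‖ ^ 2 - σ * inner ℝ p w =
      2 * inner ℝ p (U - p - (σ / 2) • w) + ‖U - p‖ ^ 2 := by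
    have hU : ‖U‖ ^ 2 = ‖p + (U - p)‖ ^ 2 := by rw [add_sub_cancel]
    rw [hU, norm_add_sq_real, inner_sub_right p (U - p), inner_smul_right]
    ring
  have hinner : |inner ℝ p (U - p - (σ / 2) • w)| ≤ B * (B * σ ^ 2) :=
    (abs_real_inner_le_norm _ _).trans
      (mul_le_mul hp h2 (norm_nonneg _) ((norm_nonneg _).trans hp))
  have hsq : ‖U - p‖ ^ 2 ≤ (B * |σ|) ^ 2 := by gcongr
  rw [mul_pow, sq_abs] at hsq
  rw [expand, abs_le]
  have := abs_le.mp hinner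
  constructor <;> nlinarith [sq_nonneg ‖U - p‖]

/-- Squared norms are Lipschitz on bounded sets. -/
lemma abs_norm_sq_sub_norm_sq_le {E : Type*} [SeminormedAddCommGroup E] {x y : E} {R S : ℝ}
    (hx : ‖x‖ ≤ R) (hy : ‖y‖ ≤ S) :
    |‖x‖ ^ 2 - ‖y‖ ^ 2| ≤ (R + S) * ‖x - y‖ := by
  rw [sq_sub_sq, abs_mul, abs_of_nonneg (by positivity : 0 ≤ ‖x‖ + ‖y‖)]
  exact mul_le_mul (add_le_add hx hy) (abs_norm_sub_norm_le x y) (abs_nonneg _)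
    (add_nonneg ((norm_nonneg x).trans hx) ((norm_nonneg y).trans hy))

/-- The averaged coefficient is consistent with `1 / (2 g)` once the weighted mean of `P` and `Q`
is consistent with `g`. -/
lemma abs_weighted_coefficient_sub_le {a b P Q g m N : ℝ} (ha : 0 < a) (hb : 0 < b) (hm : 0 < m)
    (hg : m ≤ g) (hP : m / 4 ≤ P) (hQ : m / 4 ≤ Q)
    (hN : |a * (P - g) + b * (Q - g)| ≤ (a + b) * N) :
    |(a + b) / 2 / (a * P + b * Q) - 1 / (2 * g)| ≤ 2 / m ^ 2 * N := by
  have hden : (a + b) * (m / 4) ≤ a * P + b * Q := by nlinarith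
  have hab : 0 < a + b := by positivity
  have hS : 0 < a * P + b * Q := lt_of_lt_of_le (by positivity) hden
  have hgpos : 0 < g := hm.trans_le hg
  have hN0 : 0 ≤ N := nonneg_of_mul_nonneg_right ((abs_nonneg _).trans hN) hab
  have hrepr : (a + b) / 2 / (a * P + b * Q) - 1 / (2 * g) =
      -(a * (P - g) + b * (Q - g)) / (2 * g * (a * P + b * Q)) := by
    field_simp
    ring
  rw [hrepr, abs_div, abs_neg, abs_of_pos (by positivity : 0 < 2 * g * (a * P + b * Q)),
    div_le_iff₀ (by positivity)]
  have hprod : m * ((a + b) * (m / 4)) ≤ g * (a * P + b * Q) := by gcongr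
  calc |a * (P - g) + b * (Q - g)| ≤ (a + b) * N := hN
    _ = 2 / m ^ 2 * N * (2 * (m * ((a + b) * (m / 4)))) := by field_simp; ring
    _ ≤ 2 / m ^ 2 * N * (2 * (g * (a * P + b * Q))) := by gcongr
    _ = _ := by ring

lemma deltaM_sub {d : ℕ} (h : ℤ → ℝ) (v w : ℤ → EuclideanSpace ℝ (Fin d)) (j : ℤ) :
    deltaM h (fun i => v i - w i) j = deltaM h v j - deltaM h w j := by
  simp only [deltaM, ← smul_sub]
  congr 1
  abel

/-- Consistency of the predictor coefficients
`α_j = ½(h_j + h_{j+1})/(h_j q_{h,j}² + h_{j+1} q_{h,j+1}²)` with `1/(2|u′(ρ_j)|²)`: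
`|α_j − 1/(2|u′(ρ_j)|²)| ≤ c(|δ⁻e_j| + |δ⁻e_{j+1}|) + c h²` for the nodal errors
`e_j = x_{h,j} − u(ρ_j)`. -/
theorem alpha_coefficient_consistency
    (d : ℕ) (hd : 2 ≤ d) (c₀ C₀ K B : ℝ)
    (hc₀ : 0 < c₀) (hC₀ : c₀ ≤ C₀) (hK : 0 < K) (hB : 0 < B) :
    ∃ c : ℝ, 0 < c ∧
      ∀ (J : ℕ), 3 ≤ J →
      ∀ (ρ : ℤ → ℝ), StrictMono ρ → ρ 0 = 0 → (∀ j : ℤ, ρ (j + (J : ℤ)) = ρ j + 1) →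
      ∀ (h : ℤ → ℝ), (∀ j : ℤ, h j = ρ j - ρ (j - 1)) →
      ∀ (hmax : ℝ), (∀ j : ℤ, h j ≤ hmax) → (∃ j : ℤ, h j = hmax) →
      (∀ j : ℤ, |h j - h (j - 1)| ≤ K * hmax ^ 2 ∧ hmax ≤ K * h j) →
      ∀ (u : ℝ → EuclideanSpace ℝ (Fin d)), ContDiff ℝ 3 u → (∀ θ : ℝ, u (θ + 1) = u θ) →
      (∀ θ : ℝ, c₀ ≤ ‖deriv u θ‖ ∧ ‖deriv u θ‖ ≤ C₀) →
      (∀ k : ℕ, k ≤ 3 → ∀ θ : ℝ, ‖iteratedDeriv k u θ‖ ≤ B) →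
      ∀ (xh : ℤ → EuclideanSpace ℝ (Fin d)), (∀ j : ℤ, xh (j + (J : ℤ)) = xh j) →
      (∀ j : ℤ, c₀ / 2 ≤ ‖deltaM h xh j‖ ∧ ‖deltaM h xh j‖ ≤ 2 * C₀) →
      ∀ j : ℤ,
        |(h j + h (j + 1)) / 2 /
              (h j * ‖deltaM h xh j‖ ^ 2 + h (j + 1) * ‖deltaM h xh (j + 1)‖ ^ 2)
            - 1 / (2 * ‖deriv u (ρ j)‖ ^ 2)|
          ≤ c * (‖deltaM h (fun i => xh i - u (ρ i)) j‖
                + ‖deltaM h (fun i => xh i - u (ρ i)) (j + 1)‖)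
            + c * hmax ^ 2 := by
  refine ⟨2 / (c₀ ^ 2) ^ 2 * ((2 * C₀ + B) + (K + 3) * B ^ 2), by
    have : 0 < C₀ := hc₀.trans_le hC₀
    positivity, ?_⟩
  intro J _ ρ hρ _ _ h hh hmax hle _ hmesh u hu _ hu' hbound xh _ hxh j
  have hpos (i : ℤ) : 0 < h i := by
    rw [hh]
    exact sub_pos.mpr (hρ (by lia))
  set p := deriv u (ρ j)
  set w := iteratedDeriv 2 u (ρ j)
  set U₁ := deltaM h (fun i => u (ρ i)) j with hU₁
  set U₂ := deltaM h (fun i => u (ρ i)) (j + 1) with hU₂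
  have hU₁' : U₁ = (-h j)⁻¹ • (u (ρ j + -h j) - u (ρ j)) := by
    rw [hU₁, deltaM, show ρ j + -h j = ρ (j - 1) by rw [hh]; ring, inv_neg, neg_smul, ← smul_neg,
      neg_sub]
  have hU₂' : U₂ = (h (j + 1))⁻¹ • (u (ρ j + h (j + 1)) - u (ρ j)) := by
    rw [hU₂, deltaM, show ρ j + h (j + 1) = ρ (j + 1) by rw [hh, add_sub_cancel_right]; ring,
      add_sub_cancel_right]
  obtain ⟨bd₁, lin₁, quad₁⟩ :=
    difference_quotient_bounds hB.le hu hbound (ρ j) (neg_ne_zero.mpr (hpos j).ne')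
  obtain ⟨bd₂, lin₂, quad₂⟩ :=
    difference_quotient_bounds hB.le hu hbound (ρ j) (hpos (j + 1)).ne'
  rw [← hU₁'] at bd₁ lin₁ quad₁
  rw [← hU₂'] at bd₂ lin₂ quad₂
  have hp : ‖p‖ ≤ B := by
    simpa [iteratedDeriv_one] using hbound 1 (by norm_num) (ρ j)
  have hw : ‖w‖ ≤ B := hbound 2 (by norm_num) (ρ j)
  have hpw : |inner ℝ p w| ≤ B ^ 2 := by
    rw [sq]
    exact (abs_real_inner_le_norm _ _).trans (mul_le_mul hp hw (norm_nonneg _) hB.le)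
  have exp₁ := abs_norm_sq_sub_le_of_expansion hp lin₁ quad₁
  have exp₂ := abs_norm_sq_sub_le_of_expansion hp lin₂ quad₂
  have per₁ := abs_norm_sq_sub_norm_sq_le (hxh j).2 bd₁
  have per₂ := abs_norm_sq_sub_norm_sq_le (hxh (j + 1)).2 bd₂
  rw [deltaM_sub h xh (fun i => u (ρ i)), deltaM_sub h xh (fun i => u (ρ i)), ← hU₁, ← hU₂]
  have sq_lower {y : ℝ} (hy : c₀ / 2 ≤ y) : c₀ ^ 2 / 4 ≤ y ^ 2 := by nlinarith
  set E₁ := ‖deltaM h xh j - U₁‖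
  set E₂ := ‖deltaM h xh (j + 1) - U₂‖
  have hE₁ : 0 ≤ E₁ := norm_nonneg _
  have hE₂ : 0 ≤ E₂ := norm_nonneg _
  have hLpos : 0 ≤ 2 * C₀ + B := by linarith
  have main := abs_weighted_coefficient_sub_le (hpos j) (hpos (j + 1)) (pow_pos hc₀ 2)
    (pow_le_pow_left₀ hc₀.le (hu' (ρ j)).1 2) (sq_lower (hxh j).1) (sq_lower (hxh (j + 1)).1)
    (N := (2 * C₀ + B) * (E₁ + E₂) + (K + 3) * B ^ 2 * hmax ^ 2) ?_
  · refine main.trans ?_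
    rw [← mul_add, mul_assoc (2 / (c₀ ^ 2) ^ 2)]
    gcongr
    nlinarith [mul_nonneg hLpos (sq_nonneg hmax),
      mul_nonneg (by positivity : 0 ≤ (K + 3) * B ^ 2) (add_nonneg hE₁ hE₂)]
  · set a := h j
    set b := h (j + 1)
    have ha : 0 < a := hpos j
    have hb : 0 < b := hpos (j + 1)
    have ha2 : a ^ 2 ≤ hmax ^ 2 := pow_le_pow_left₀ ha.le (hle j) 2
    have hb2 : b ^ 2 ≤ hmax ^ 2 := pow_le_pow_left₀ hb.le (hle (j + 1)) 2
    have hba : |b - a| ≤ K * hmax ^ 2 := by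
      simpa [a, b] using (hmesh (j + 1)).1
    have split : a * (‖deltaM h xh j‖ ^ 2 - ‖p‖ ^ 2)
          + b * (‖deltaM h xh (j + 1)‖ ^ 2 - ‖p‖ ^ 2) =
        a * ((‖deltaM h xh j‖ ^ 2 - ‖U₁‖ ^ 2) + (‖U₁‖ ^ 2 - ‖p‖ ^ 2 - -a * inner ℝ p w))
        + b * ((‖deltaM h xh (j + 1)‖ ^ 2 - ‖U₂‖ ^ 2) + (‖U₂‖ ^ 2 - ‖p‖ ^ 2 - b * inner ℝ p w))
        + (a + b) * ((b - a) * inner ℝ p w) := by ring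
    have weigh {t x y X Y : ℝ} (ht : 0 < t) (hx : |x| ≤ X) (hy : |y| ≤ Y) :
        |t * (x + y)| ≤ t * (X + Y) := by
      rw [abs_mul, abs_of_pos ht]
      gcongr
      exact (abs_add_le _ _).trans (add_le_add hx hy)
    have cross : |(a + b) * ((b - a) * inner ℝ p w)| ≤ (a + b) * (K * hmax ^ 2 * B ^ 2) := by
      rw [abs_mul, abs_mul, abs_of_pos (add_pos ha hb)]
      gcongr
    rw [neg_sq] at exp₁
    rw [split]
    refine (abs_add_three _ _ _).trans
      ((add_le_add_three (weigh ha per₁ exp₁) (weigh hb per₂ exp₂) cross).trans ?_)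
    calc a * ((2 * C₀ + B) * E₁ + 3 * B ^ 2 * a ^ 2)
          + b * ((2 * C₀ + B) * E₂ + 3 * B ^ 2 * b ^ 2) + (a + b) * (K * hmax ^ 2 * B ^ 2)
        ≤ a * ((2 * C₀ + B) * (E₁ + E₂) + 3 * B ^ 2 * hmax ^ 2)
          + b * ((2 * C₀ + B) * (E₁ + E₂) + 3 * B ^ 2 * hmax ^ 2)
          + (a + b) * (K * hmax ^ 2 * B ^ 2) := by
          gcongr <;> linarith
      _ = _ := by ring
end
end

section
/- Let x : ℝ × [0, T′] → ℝ^d be 1-periodic in its first argument and smooth, let 0 ≤ t_m and Δt > 0 with t_m + ½Δt ≤ T′, and define the function g : ℝ → ℝ^d by g(ρ) = ½Δt [ x_t(ρ, t_m) − ( x(ρ, t_m + ½Δt) − x(ρ, t_m) )/(½Δt) ]. Then the grid function g_j = g(ρ_j) satisfies |δ⁻g_j| ≤ (Δt)² · sup{ |x_{ttρ}(ρ, t)| : ρ ∈ ℝ, t ∈ [t_m, t_m + ½Δt] } for all j = 1,…,J. -/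
open scoped BigOperators

noncomputable section

section

variable {E : Type*} [NormedAddCommGroup E] [NormedSpace ℝ E]

/-- The derivative of a map on the plane along its first variable. -/
theorem hasDerivAt_fst_slice {F : ℝ × ℝ → E} {p : ℝ × ℝ} (hF : DifferentiableAt ℝ F p) :
    HasDerivAt (fun r => F (r, p.2)) (fderiv ℝ F p (1, 0)) p.1 :=
  HasFDerivAt.comp_hasDerivAt (l := F) (f := fun r => (r, p.2)) p.1 hF.hasFDerivAt
    ((hasDerivAt_id p.1).prodMk (hasDerivAt_const p.1 p.2))

/-- The derivative of a map on the plane along its second variable. -/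
theorem hasDerivAt_snd_slice {F : ℝ × ℝ → E} {p : ℝ × ℝ} (hF : DifferentiableAt ℝ F p) :
    HasDerivAt (fun s => F (p.1, s)) (fderiv ℝ F p (0, 1)) p.2 :=
  HasFDerivAt.comp_hasDerivAt (l := F) (f := fun s => (p.1, s)) p.2 hF.hasFDerivAt
    ((hasDerivAt_const p.2 p.1).prodMk (hasDerivAt_id p.2))

/-- Directional derivatives of a `C^(n+1)` map are `C^n`. -/
theorem ContDiff.fderiv_apply_const {F : ℝ × ℝ → E} {n m : WithTop ℕ∞} (hF : ContDiff ℝ n F)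
    (hmn : m + 1 ≤ n) (v : ℝ × ℝ) : ContDiff ℝ m (fun p => fderiv ℝ F p v) :=
  (hF.fderiv_right hmn).clm_apply contDiff_const

/-- Directional derivatives of a `C^2` map commute. -/
theorem ContDiff.fderiv_fderiv_apply_comm {F : ℝ × ℝ → E} (hF : ContDiff ℝ 2 F)
    (p v w : ℝ × ℝ) :
    fderiv ℝ (fun q => fderiv ℝ F q v) p w = fderiv ℝ (fun q => fderiv ℝ F q w) p v := by
  have hdiff : DifferentiableAt ℝ (fderiv ℝ F) p :=
    (hF.fderiv_right (m := 1) (by norm_num)).differentiable (by norm_num) p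
  have key : ∀ u z : ℝ × ℝ,
      fderiv ℝ (fun q => fderiv ℝ F q u) p z = fderiv ℝ (fderiv ℝ F) p z u := by
    intro u z
    rw [fderiv_clm_apply hdiff (differentiableAt_const u)]
    simp
  rw [key, key]
  exact (hF.contDiffAt.isSymmSndFDerivAt (by simp)).eq w v

/-- First-order Taylor remainder estimate for a curve with bounded second derivative. -/
theorem norm_smul_deriv_sub_increment_le {φ φ' φ'' : ℝ → E} {a k M : ℝ} (hk : 0 ≤ k)
    (hφ : ∀ t, HasDerivAt φ (φ' t) t) (hφ' : ∀ t, HasDerivAt φ' (φ'' t) t)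
    (hM : ∀ t ∈ Set.Icc a (a + k), ‖φ'' t‖ ≤ M) :
    ‖k • φ' a - (φ (a + k) - φ a)‖ ≤ M * k ^ 2 := by
  have hM0 : 0 ≤ M := (norm_nonneg _).trans (hM a ⟨le_rfl, by linarith⟩)
  have hvel : ∀ t ∈ Set.Icc a (a + k), ‖φ' t - φ' a‖ ≤ M * (t - a) :=
    norm_image_sub_le_of_norm_deriv_le_segment' (fun t _ => (hφ' t).hasDerivWithinAt)
      fun t ht => hM t ⟨ht.1, ht.2.le⟩
  have hrem := norm_image_sub_le_of_norm_deriv_le_segment' (a := a) (b := a + k)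
    (f := fun t => φ t - (t - a) • φ' a) (f' := fun t => φ' t - φ' a) (C := M * k)
    (fun t _ => by
      have := (hφ t).fun_sub (((hasDerivAt_id t).sub_const a).smul_const (φ' a))
      simp only [one_smul] at this
      exact this.hasDerivWithinAt)
    (fun t ht => (hvel t ⟨ht.1, ht.2.le⟩).trans
      (mul_le_mul_of_nonneg_left (by linarith [ht.2]) hM0))
    (a + k) ⟨by linarith, le_rfl⟩
  rw [← norm_neg]
  convert hrem using 1
  · congr 1
    simp only [add_sub_cancel_left, sub_self, zero_smul]
    abel
  · ring

/-- A continuous function on the plane, `1`-periodic in its first variable, is bounded above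
on horizontal strips of compact height. -/
theorem bddAbove_image_strip_of_periodic {f : ℝ × ℝ → ℝ} (hf : Continuous f)
    (hper : ∀ t, Function.Periodic (fun θ => f (θ, t)) 1) (a b : ℝ) :
    BddAbove (f '' (Set.univ ×ˢ Set.Icc a b)) := by
  refine ((isCompact_Icc (a := (0 : ℝ)) (b := 1)).prod
    (isCompact_Icc (a := a) (b := b))).bddAbove_image hf.continuousOn |>.mono ?_
  rintro _ ⟨⟨θ, t⟩, ⟨-, ht⟩, rfl⟩
  refine ⟨(Int.fract θ, t), ⟨⟨Int.fract_nonneg θ, (Int.fract_lt_one θ).le⟩, ht⟩, ?_⟩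
  simpa only [mul_one, Int.self_sub_floor] using (hper t).sub_int_mul_eq ⌊θ⌋ (x := θ)

end

/-- Difference quotient bound for the first consistency term of the predictor step:
for `g(ρ) = ½Δt [x_t(ρ,t_m) − (x(ρ,t_m+½Δt) − x(ρ,t_m))/(½Δt)]` one has
`|δ⁻g_j| ≤ (Δt)² sup_{ρ∈ℝ, t∈[t_m,t_m+½Δt]} |x_{ttρ}(ρ,t)|`. -/
theorem predictor_consistency_term_bound
    (d : ℕ) (hd : 2 ≤ d) (J : ℕ) (hJ : 3 ≤ J)
    (ρ : ℤ → ℝ) (hmono : StrictMono ρ) (hρ0 : ρ 0 = 0)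
    (hρper : ∀ j : ℤ, ρ (j + (J : ℤ)) = ρ j + 1)
    (h : ℤ → ℝ) (hh : ∀ j : ℤ, h j = ρ j - ρ (j - 1))
    (T' : ℝ) (x : ℝ → ℝ → EuclideanSpace ℝ (Fin d))
    (hx : ContDiff ℝ 3 (Function.uncurry x))
    (hxper : ∀ (θ t : ℝ), x (θ + 1) t = x θ t)
    (tm Δt : ℝ) (htm : 0 ≤ tm) (hΔt : 0 < Δt) (hT : tm + Δt / 2 ≤ T') :
    ∀ j : ℤ,
      ‖deltaM h
          (fun i =>
            (Δt / 2) • (deriv (x (ρ i)) tm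
              - ((Δt / 2)⁻¹) • (x (ρ i) (tm + Δt / 2) - x (ρ i) tm))) j‖
        ≤ Δt ^ 2 *
            sSup ((fun p : ℝ × ℝ =>
                ‖deriv (fun s => deriv (fun s' => deriv (fun r => x r s') p.1) s) p.2‖) ''
              (Set.univ ×ˢ Set.Icc tm (tm + Δt / 2))) := by
  intro j
  set F : ℝ × ℝ → EuclideanSpace ℝ (Fin d) := Function.uncurry x
  set P : ℝ × ℝ → EuclideanSpace ℝ (Fin d) := fun p => fderiv ℝ F p (1, 0)
  set Q : ℝ × ℝ → EuclideanSpace ℝ (Fin d) := fun p => fderiv ℝ F p (0, 1)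
  set R : ℝ × ℝ → EuclideanSpace ℝ (Fin d) := fun p => fderiv ℝ P p (0, 1)
  set S : ℝ × ℝ → EuclideanSpace ℝ (Fin d) := fun p => fderiv ℝ R p (0, 1)
  have hP : ContDiff ℝ 2 P := hx.fderiv_apply_const (by norm_num) _
  have hQ : ContDiff ℝ 2 Q := hx.fderiv_apply_const (by norm_num) _
  have hR : ContDiff ℝ 1 R := hP.fderiv_apply_const (by norm_num) _
  have hS : ContDiff ℝ 0 S := hR.fderiv_apply_const (by norm_num) _
  have hFr : ∀ r s, HasDerivAt (fun r => x r s) (P (r, s)) r := fun r s =>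
    hasDerivAt_fst_slice (p := (r, s)) (hx.differentiable (by norm_num) _)
  have hFt : ∀ r s, HasDerivAt (x r) (Q (r, s)) s := fun r s =>
    hasDerivAt_snd_slice (p := (r, s)) (hx.differentiable (by norm_num) _)
  have hPt : ∀ r s, HasDerivAt (fun s => P (r, s)) (R (r, s)) s := fun r s =>
    hasDerivAt_snd_slice (p := (r, s)) (hP.differentiable (by norm_num) _)
  have hRt : ∀ r s, HasDerivAt (fun s => R (r, s)) (S (r, s)) s := fun r s =>
    hasDerivAt_snd_slice (p := (r, s)) (hR.differentiable (by norm_num) _)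
  have hQr : ∀ r s, HasDerivAt (fun r => Q (r, s)) (R (r, s)) r := fun r s => by
    have hcomm : R (r, s) = fderiv ℝ Q (r, s) (1, 0) :=
      (hx.of_le (by norm_num)).fderiv_fderiv_apply_comm _ _ _
    rw [hcomm]
    exact hasDerivAt_fst_slice (p := (r, s)) (hQ.differentiable (by norm_num) _)
  have hmixed : (fun p : ℝ × ℝ =>
      ‖deriv (fun s => deriv (fun s' => deriv (fun r => x r s') p.1) s) p.2‖)
      = fun p => ‖S p‖ := by
    funext p
    simp only [fun r s => (hFr r s).deriv, fun r s => (hPt r s).deriv,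
      fun r s => (hRt r s).deriv]
  have hPper : ∀ θ s, P (θ + 1, s) = P (θ, s) := fun θ s => by
    rw [← (hFr (θ + 1) s).deriv, ← (hFr θ s).deriv,
      ← deriv_comp_add_const (fun r => x r s) 1 θ]
    simp only [hxper]
  have hRper : ∀ θ s, R (θ + 1, s) = R (θ, s) := fun θ s => by
    rw [← (hPt (θ + 1) s).deriv, ← (hPt θ s).deriv]
    simp only [hPper]
  have hSper : ∀ θ s, S (θ + 1, s) = S (θ, s) := fun θ s => by
    rw [← (hRt (θ + 1) s).deriv, ← (hRt θ s).deriv]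
    simp only [hRper]
  rw [hmixed]
  set M := sSup ((fun p : ℝ × ℝ => ‖S p‖) '' (Set.univ ×ˢ Set.Icc tm (tm + Δt / 2)))
  have hbound : ∀ r, ∀ t ∈ Set.Icc tm (tm + Δt / 2), ‖S (r, t)‖ ≤ M := fun r t ht =>
    le_csSup (bddAbove_image_strip_of_periodic hS.continuous.norm
      (fun t θ => by simp only [hSper]) _ _) ⟨(r, t), ⟨Set.mem_univ _, ht⟩, rfl⟩
  have hM0 : 0 ≤ M :=
    (norm_nonneg _).trans (hbound 0 tm ⟨le_rfl, by linarith⟩)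
  set g : ℝ → EuclideanSpace ℝ (Fin d) := fun r =>
    (Δt / 2) • Q (r, tm) - (x r (tm + Δt / 2) - x r tm)
  have hg : ∀ r, HasDerivAt g
      ((Δt / 2) • R (r, tm) - (P (r, tm + Δt / 2) - P (r, tm))) r := fun r =>
    ((hQr r tm).const_smul (Δt / 2)).sub ((hFr r _).sub (hFr r _))
  have hglip : ‖g (ρ j) - g (ρ (j - 1))‖ ≤ M * (Δt / 2) ^ 2 * ‖ρ j - ρ (j - 1)‖ :=
    convex_univ.norm_image_sub_le_of_norm_hasDerivWithin_le
      (fun r _ => (hg r).hasDerivWithinAt)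
      (fun r _ => norm_smul_deriv_sub_increment_le (by positivity) (hPt r) (hRt r) (hbound r))
      (Set.mem_univ _) (Set.mem_univ _)
  have hgrid : ∀ r, (Δt / 2) • (deriv (x r) tm
      - ((Δt / 2)⁻¹) • (x r (tm + Δt / 2) - x r tm)) = g r := fun r => by
    rw [(hFt r tm).deriv, smul_sub, smul_inv_smul₀ (by positivity)]
  have hpos : 0 < ρ j - ρ (j - 1) := sub_pos.2 (hmono (by lia))
  simp only [deltaM, hgrid, hh j]
  rw [norm_smul, norm_inv, inv_mul_le_iff₀ (norm_pos_iff.2 hpos.ne')]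
  refine hglip.trans ?_
  rw [mul_comm]
  refine mul_le_mul_of_nonneg_left ?_ (norm_nonneg _)
  nlinarith [mul_nonneg hM0 (sq_nonneg Δt)]
end
end
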